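/- arXiv:2507.12748 — 5 statements merged into one kernel-verified Lean document; each statement's English description precedes it below -/
import Mathlib

section
/- Let n ≥ 2 and let κ : Fin n → ℕ be a nonincreasing sequence of nonnegative integers summing to m, and let p, p' : Fin m → Fin n be two (m,n)-partitions both of shape (κ(1), …, κ(n)) (i.e., |p⁻¹(i)| = κ(i) = |p'⁻¹(i)| for every i). Then there exists a p-cycle decomposition of (p, p') of length at most κ(1) + ⌈κ(2)/2⌉; that is, there exist d ≤ κ(1) + ⌈κ(2)/2⌉ and p-cycles σ₁, …, σ_d of Fin m with p' = p ∘ σ_d ∘ ⋯ ∘ σ₁. (By the characterization of the edges of the partition polytope, this is equivalent to the statement that the combinatorial diameter of the partition polytope PP(κ₁, …, κₙ) is at most κ₁ + ⌈κ₂/2⌉.) -/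
/-- The support of a permutation of `Fin m`, as a set. -/
def psupp {m : ℕ} (π : Equiv.Perm (Fin m)) : Set (Fin m) := {x | π x ≠ x}

/-- A permutation `π` is `p`-balanced if `p` is injective on the support of `π`. -/
def IsBalanced {m n : ℕ} (p : Fin m → Fin n) (π : Equiv.Perm (Fin m)) : Prop :=
  Set.InjOn p (psupp π)

/-- A `p`-cycle is a `p`-balanced permutation that is the identity or a cycle. -/
def IsPCycle {m n : ℕ} (p : Fin m → Fin n) (π : Equiv.Perm (Fin m)) : Prop :=
  IsBalanced p π ∧ (π = 1 ∨ π.IsCycle)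

/-- The size of the fiber of `p` over `i`. -/
def fiberCard {m n : ℕ} (p : Fin m → Fin n) (i : Fin n) : ℕ :=
  (Finset.univ.filter fun x => p x = i).card

open Equiv Equiv.Perm

section Cycles

theorem sameCycle_mul_of_disjoint {X : Type*} {f g : Perm X} (hfg : Perm.Disjoint f g)
    {x y : X} (hx : g x = x) (hxy : SameCycle f x y) : SameCycle (f * g) x y := by
  obtain ⟨i, rfl⟩ := hxy
  refine ⟨i, ?_⟩
  rw [hfg.commute.mul_zpow, Perm.mul_apply, zpow_apply_eq_self_of_apply_eq_self hx]

variable {X : Type*} [Fintype X] [DecidableEq X]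

theorem sameCycle_swap_mul_left {g : Perm X} {u v x : X} (huv : ¬ SameCycle g u v)
    (hx : SameCycle g u x) : SameCycle (swap u v * g) u x := by
  have key : ∀ n : ℕ, SameCycle (swap u v * g) u ((g ^ n) u) := by
    intro n
    induction n with
    | zero => exact SameCycle.refl _ _
    | succ n ih =>
      by_cases h : (g ^ (n + 1)) u = u
      · rw [h]
      · have hv : (g ^ (n + 1)) u ≠ v := fun h' => huv ⟨(n + 1 : ℕ), by rwa [zpow_natCast]⟩
        have hstep : (swap u v * g) ((g ^ n) u) = (g ^ (n + 1)) u := by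
          rw [Perm.mul_apply, ← Perm.mul_apply g, ← pow_succ', swap_apply_of_ne_of_ne h hv]
        rw [← hstep]
        exact sameCycle_apply_right.2 ih
  obtain ⟨n, -, rfl⟩ := hx.exists_pow_eq'
  exact key n

theorem sameCycle_swap_mul_swap {g : Perm X} {u v : X} (huv : ¬ SameCycle g u v) :
    SameCycle (swap u v * g) u v := by
  have h : SameCycle (swap u v * g) u (g⁻¹ u) :=
    sameCycle_swap_mul_left huv ⟨-1, by simp⟩
  have := sameCycle_apply_right.2 h
  simpa using this

/-- Multiplying by a transposition merges the two cycles it meets. -/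
theorem sameCycle_swap_mul {g : Perm X} {u v x : X} (huv : ¬ SameCycle g u v)
    (hx : SameCycle g u x ∨ SameCycle g v x) : SameCycle (swap u v * g) u x := by
  rcases hx with hx | hx
  · exact sameCycle_swap_mul_left huv hx
  · refine (sameCycle_swap_mul_swap huv).trans ?_
    rw [swap_comm]
    exact sameCycle_swap_mul_left (fun h => huv h.symm) hx

/-- `f` fixes everything outside `S` and permutes `S` in a single cycle
(which is trivial if `S` is a singleton). -/
def IsCycleWithin (f : Perm X) (S : Set X) : Prop :=
  (∀ x, x ∉ S → f x = x) ∧ ∀ x ∈ S, ∀ y ∈ S, SameCycle f x y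

theorem IsCycleWithin.eq_one_or_isCycle {f : Perm X} {S : Set X} (h : IsCycleWithin f S) :
    f = 1 ∨ f.IsCycle := by
  by_cases h1 : f = 1
  · exact Or.inl h1
  · right
    obtain ⟨x, hx⟩ : ∃ x, f x ≠ x := by
      by_contra! hc
      exact h1 (Equiv.ext hc)
    have hS : ∀ y, f y ≠ y → y ∈ S := fun y hy => by
      by_contra hc
      exact hy (h.1 y hc)
    exact ⟨x, hx, fun y hy => h.2 x (hS x hx) y (hS y hy)⟩

theorem IsCycleWithin.swap_mul_mul {f g : Perm X} {S T : Set X} (hf : IsCycleWithin f S)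
    (hg : IsCycleWithin g T) (hST : _root_.Disjoint S T) {u v : X} (hu : u ∈ S) (hv : v ∈ T) :
    IsCycleWithin (swap u v * (f * g)) (S ∪ T) := by
  have hS : ∀ x ∈ S, g x = x := fun x hx => hg.1 x (Set.disjoint_left.1 hST hx)
  have hT : ∀ x ∈ T, f x = x := fun x hx => hf.1 x (Set.disjoint_right.1 hST hx)
  have hfg : Perm.Disjoint f g := fun x => by
    by_cases hx : x ∈ S
    · exact Or.inr (hS x hx)
    · exact Or.inl (hf.1 x hx)
  have huv : ¬ SameCycle (f * g) u v := by
    rintro ⟨i, hi⟩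
    rw [hfg.commute.mul_zpow, Perm.mul_apply,
      zpow_apply_eq_self_of_apply_eq_self (hS u hu)] at hi
    have h2 := zpow_apply_eq_self_of_apply_eq_self (hT v hv) i
    have : u = v := (f ^ i).injective (hi.trans h2.symm)
    exact Set.disjoint_left.1 hST hu (this ▸ hv)
  have key : ∀ x ∈ S ∪ T, SameCycle (swap u v * (f * g)) u x := by
    intro x hx
    refine sameCycle_swap_mul huv ?_
    rcases hx with hx | hx
    · exact Or.inl (sameCycle_mul_of_disjoint hfg (hS u hu) (hf.2 u hu x hx))
    · right
      rw [hfg.commute.eq]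
      exact sameCycle_mul_of_disjoint hfg.symm (hT v hv) (hg.2 v hv x hx)
  refine ⟨fun x hx => ?_, fun x hx y hy => (key x hx).symm.trans (key y hy)⟩
  rw [Set.mem_union, not_or] at hx
  have hxu : x ≠ u := fun h => hx.1 (h ▸ hu)
  have hxv : x ≠ v := fun h => hx.2 (h ▸ hv)
  rw [Perm.mul_apply, Perm.mul_apply, hg.1 x hx.2, hf.1 x hx.1, swap_apply_of_ne_of_ne hxu hxv]

/-- A cycle through representatives of several cycles of `α` joins these cycles into one. -/
theorem exists_joining_cycle (α : Perm X) (R : Finset X) (hR : R.Nonempty)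
    (hα : ∀ x ∈ R, ∀ y ∈ R, SameCycle α x y → x = y) :
    ∃ γ : Perm X, IsCycleWithin γ (R : Set X) ∧
      ∀ r ∈ R, ∀ x, SameCycle α r x → ∀ s ∈ R, ∀ y, SameCycle α s y → SameCycle (α * γ) x y := by
  induction hR using Finset.Nonempty.cons_induction with
  | singleton a =>
    refine ⟨1, ⟨fun x _ => rfl, ?_⟩, ?_⟩
    · intro x hx y hy
      rw [Finset.mem_coe, Finset.mem_singleton] at hx hy
      rw [hx, hy]
    · intro r hr x hx s hs y hy
      rw [Finset.mem_singleton] at hr hs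
      subst hr hs
      simpa using hx.symm.trans hy
  | cons a R ha hne ih =>
    obtain ⟨γ, hγ, hj⟩ := ih fun x hx y hy =>
      hα x (Finset.mem_cons_of_mem hx) y (Finset.mem_cons_of_mem hy)
    obtain ⟨b, hb⟩ := hne
    have hfix : ∀ x, SameCycle α a x → γ x = x := fun x hx => hγ.1 x fun hxR =>
      ha (hα a (Finset.mem_cons_self a R) x (Finset.mem_cons_of_mem hxR) hx ▸ hxR)
    have hpow : ∀ n : ℕ, ((α * γ) ^ n) a = (α ^ n) a := by
      intro n
      induction n with
      | zero => rfl
      | succ n ihn =>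
        rw [pow_succ', Perm.mul_apply, ihn, Perm.mul_apply, hfix _ ⟨n, by simp⟩, pow_succ',
          Perm.mul_apply]
    have horb : ∀ x, SameCycle α a x ↔ SameCycle (α * γ) a x := by
      intro x
      constructor
      · intro h
        obtain ⟨n, -, rfl⟩ := h.exists_pow_eq'
        exact ⟨n, by simpa using hpow n⟩
      · intro h
        obtain ⟨n, -, rfl⟩ := h.exists_pow_eq'
        rw [hpow]
        exact ⟨n, by simp⟩
    have hb' : SameCycle (α * γ) b (α b) :=
      hj b hb b (SameCycle.refl _ _) b hb _ (sameCycle_apply_right.2 (SameCycle.refl _ _))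
    have hab : ¬ SameCycle (α * γ) (α a) (α b) := by
      intro h
      have h1 : SameCycle α a (α b) := (horb _).2
        (((horb _).1 (sameCycle_apply_right.2 (SameCycle.refl _ _))).trans h)
      have h2 := hα a (Finset.mem_cons_self a R) b (Finset.mem_cons_of_mem hb)
        (sameCycle_apply_right.1 h1)
      exact ha (h2 ▸ hb)
    have hmul : α * (swap a b * γ) = swap (α a) (α b) * (α * γ) := by
      rw [swap_apply_apply α a b]
      simp only [mul_assoc, inv_mul_cancel_left]
    refine ⟨swap a b * γ, ?_, ?_⟩
    · have h1 : IsCycleWithin (1 : Perm X) ({a} : Set X) := by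
        refine ⟨fun x _ => rfl, ?_⟩
        rintro x rfl y rfl
        exact SameCycle.refl _ _
      have := h1.swap_mul_mul hγ (by simpa using ha) (Set.mem_singleton a) (Finset.mem_coe.2 hb)
      rwa [one_mul, Set.singleton_union, ← Finset.coe_insert,
        ← Finset.cons_eq_insert _ _ ha] at this
    · have key : ∀ r ∈ Finset.cons a R ha, ∀ x, SameCycle α r x →
          SameCycle (α * (swap a b * γ)) (α a) x := by
        intro r hr x hx
        rw [hmul]
        refine sameCycle_swap_mul hab ?_
        rcases Finset.mem_cons.1 hr with rfl | hr
        · left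
          exact ((horb _).1 (sameCycle_apply_right.2 (SameCycle.refl _ _))).symm.trans
            ((horb _).1 hx)
        · right
          exact hb'.symm.trans (hj b hb b (SameCycle.refl _ _) r hr x hx)
      intro r hr x hx s hs y hy
      exact (key r hr x hx).symm.trans (key s hs y hy)

theorem exists_joining_cycle_of_transversal (α : Perm X) (R : Finset X) (hne : R.Nonempty)
    (hsupp : ∀ x ∈ R, α x ≠ x) (hα : ∀ x ∈ R, ∀ y ∈ R, SameCycle α x y → x = y)
    (hcov : ∀ x, α x ≠ x → ∃ r ∈ R, SameCycle α r x) :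
    ∃ γ : Perm X, IsCycleWithin γ (R : Set X) ∧ IsCycleWithin (α * γ) {x | α x ≠ x} := by
  obtain ⟨γ, hγ, hj⟩ := exists_joining_cycle α R hne hα
  refine ⟨γ, hγ, ?_, ?_⟩
  · intro x hx
    have hx' : α x = x := by simpa using hx
    rw [Perm.mul_apply, hγ.1 x fun h => hsupp x h hx', hx']
  · intro x hx y hy
    obtain ⟨r, hr, hrx⟩ := hcov x hx
    obtain ⟨s, hs, hsy⟩ := hcov y hy
    exact hj r hr x hrx s hs y hsy

end Cycles

section Transversals

/-- Two families of pairwise disjoint sets of size at least two have a common system of distinct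
representatives, even if one element may not represent sets of the second family. -/
theorem exists_injective_of_two_disjoint_families {ι κ V : Type*} [DecidableEq V]
    (s : ι → Finset V) (t : κ → Finset V)
    (hs : Pairwise fun i j => _root_.Disjoint (s i) (s j))
    (ht : Pairwise fun i j => _root_.Disjoint (t i) (t j))
    (hs2 : ∀ i, 2 ≤ (s i).card) (ht2 : ∀ j, 2 ≤ (t j).card) (a : V) :
    ∃ f : ι ⊕ κ → V, Function.Injective f ∧ (∀ i, f (Sum.inl i) ∈ s i) ∧
      ∀ j, f (Sum.inr j) ∈ t j ∧ f (Sum.inr j) ≠ a := by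
  classical
  obtain ⟨f, hf, hmem⟩ := (Finset.all_card_le_biUnion_card_iff_exists_injective
    (Sum.elim s fun j => (t j).erase a)).1 (by
      intro U
      have hcard : U.card = U.toLeft.card + U.toRight.card :=
        (Finset.card_toLeft_add_card_toRight (u := U)).symm
      have h1 : 2 * U.toLeft.card ≤
          (U.biUnion (Sum.elim s fun j => (t j).erase a)).card := by
        calc 2 * U.toLeft.card = ∑ i ∈ U.toLeft, 2 := by simp [mul_comm]
          _ ≤ ∑ i ∈ U.toLeft, (s i).card := Finset.sum_le_sum fun i _ => hs2 i
          _ = (U.toLeft.biUnion s).card :=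
            (Finset.card_biUnion fun i _ j _ hij => hs hij).symm
          _ ≤ _ := by
            refine Finset.card_le_card (Finset.biUnion_subset.2 fun i hi => ?_)
            exact Finset.subset_biUnion_of_mem (Sum.elim s fun j => (t j).erase a)
              (Finset.mem_toLeft.1 hi)
      have h2 : 2 * U.toRight.card ≤
          (U.biUnion (Sum.elim s fun j => (t j).erase a)).card + 1 := by
        calc 2 * U.toRight.card = ∑ i ∈ U.toRight, 2 := by simp [mul_comm]
          _ ≤ ∑ i ∈ U.toRight, (t i).card := Finset.sum_le_sum fun i _ => ht2 i
          _ = (U.toRight.biUnion t).card :=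
            (Finset.card_biUnion fun i _ j _ hij => ht hij).symm
          _ ≤ ((U.toRight.biUnion t).erase a).card + 1 :=
            Nat.sub_le_iff_le_add.1 Finset.pred_card_le_card_erase
          _ ≤ _ := by
            refine Nat.succ_le_succ (Finset.card_le_card fun x hx => ?_)
            obtain ⟨hxa, hx⟩ := Finset.mem_erase.1 hx
            obtain ⟨j, hj, hxj⟩ := Finset.mem_biUnion.1 hx
            exact Finset.mem_biUnion.2 ⟨Sum.inr j, Finset.mem_toRight.1 hj,
              Finset.mem_erase.2 ⟨hxa, hxj⟩⟩
      omega)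
  refine ⟨f, hf, fun i => hmem (Sum.inl i), fun j => ?_⟩
  have := Finset.mem_erase.1 (hmem (Sum.inr j))
  exact ⟨this.2, this.1⟩

theorem apply_ne_of_sameCycle {X : Type*} {α : Perm X} {x y : X} (h : SameCycle α x y)
    (hx : α x ≠ x) : α y ≠ y := fun hy => hx (h.apply_eq_self_iff.2 hy)

variable {X : Type*} [Fintype X] [DecidableEq X]

/-- `R` contains exactly one element of every nontrivial cycle of `α`, and nothing else. -/
structure IsTransversal (α : Perm X) (R : Finset X) : Prop where
  apply_ne : ∀ x ∈ R, α x ≠ x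
  eq_of_sameCycle : ∀ x ∈ R, ∀ y ∈ R, SameCycle α x y → x = y
  exists_sameCycle : ∀ x, α x ≠ x → ∃ r ∈ R, SameCycle α r x

theorem exists_isTransversal (α : Perm X) : ∃ R, IsTransversal α R := by
  classical
  let rep : X → X := fun x => (Quotient.mk (SameCycle.setoid α) x).out
  have hrep : ∀ x, SameCycle α (rep x) x := fun x =>
    Quotient.exact (Quotient.out_eq (Quotient.mk (SameCycle.setoid α) x))
  have hrep_eq : ∀ x y, SameCycle α x y → rep x = rep y := fun x y h =>
    congrArg Quotient.out (Quotient.sound (s := SameCycle.setoid α) h)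
  refine ⟨Finset.univ.filter fun x => α x ≠ x ∧ rep x = x, ⟨fun x hx => ?_, ?_, ?_⟩⟩
  · exact (Finset.mem_filter.1 hx).2.1
  · intro x hx y hy h
    rw [← (Finset.mem_filter.1 hx).2.2, ← (Finset.mem_filter.1 hy).2.2, hrep_eq x y h]
  · intro x hx
    refine ⟨rep x, ?_, hrep x⟩
    simp only [Finset.mem_filter, Finset.mem_univ, true_and]
    exact ⟨apply_ne_of_sameCycle (hrep x).symm hx, hrep_eq _ _ (hrep x)⟩

theorem IsTransversal.insert_image {α : Perm X} {R : Finset X} (hR : IsTransversal α R) {a : X}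
    (ha : α a ≠ a) (g : {x // x ∈ R ∧ ¬ SameCycle α a x} → X)
    (hg : ∀ i, SameCycle α i.1 (g i)) : IsTransversal α (insert a (Set.range g).toFinset) := by
  refine ⟨?_, ?_, ?_⟩
  · intro x hx
    simp only [Finset.mem_insert, Set.mem_toFinset, Set.mem_range] at hx
    rcases hx with rfl | ⟨i, rfl⟩
    · exact ha
    · exact apply_ne_of_sameCycle (hg i) (hR.apply_ne i i.2.1)
  · intro x hx y hy h
    simp only [Finset.mem_insert, Set.mem_toFinset, Set.mem_range] at hx hy
    rcases hx with rfl | ⟨i, rfl⟩ <;> rcases hy with rfl | ⟨j, rfl⟩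
    · rfl
    · exact absurd (h.trans (hg j).symm) j.2.2
    · exact absurd (h.symm.trans (hg i).symm) i.2.2
    · rw [Subtype.ext (hR.eq_of_sameCycle i i.2.1 j j.2.1 ((hg i).trans (h.trans (hg j).symm)))]
  · intro x hx
    by_cases hax : SameCycle α a x
    · exact ⟨a, Finset.mem_insert_self _ _, hax⟩
    · obtain ⟨r, hr, hrx⟩ := hR.exists_sameCycle x hx
      let i : {x // x ∈ R ∧ ¬ SameCycle α a x} := ⟨r, hr, fun h => hax (h.trans hrx)⟩
      exact ⟨g i, by simp, (hg i).symm.trans hrx⟩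

/-- The classes of the cycles through `R` that avoid `a`, seen through a map `p` which is injective
on the support, are pairwise disjoint sets of size at least two. -/
theorem IsTransversal.image_classes {V : Type*} [DecidableEq V] {p : X → V} {α : Perm X}
    {R : Finset X} (hR : IsTransversal α R) (hp : Set.InjOn p {x | α x ≠ x}) (a : X) :
    (Pairwise fun i j : {x // x ∈ R ∧ ¬ SameCycle α a x} =>
      _root_.Disjoint ((Finset.univ.filter (SameCycle α i)).image p)
        ((Finset.univ.filter (SameCycle α j)).image p)) ∧
    ∀ i : {x // x ∈ R ∧ ¬ SameCycle α a x},
      2 ≤ ((Finset.univ.filter (SameCycle α i)).image p).card := by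
  constructor
  · intro i j hij
    rw [Finset.disjoint_left]
    intro v hv hv'
    simp only [Finset.mem_image, Finset.mem_filter, Finset.mem_univ, true_and] at hv hv'
    obtain ⟨x, hx, rfl⟩ := hv
    obtain ⟨y, hy, hyx⟩ := hv'
    have h := hp (apply_ne_of_sameCycle hy (hR.apply_ne j j.2.1))
      (apply_ne_of_sameCycle hx (hR.apply_ne i i.2.1)) hyx
    subst h
    exact hij (Subtype.ext (hR.eq_of_sameCycle i i.2.1 j j.2.1 (hx.trans hy.symm)))
  · intro i
    have hi := hR.apply_ne i i.2.1
    have hi' : α (α i) ≠ α i := fun h => hi (α.injective h)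
    refine Finset.one_lt_card.2 ⟨p i, ?_, p (α i), ?_, fun h => hi (hp hi hi' h).symm⟩
    · exact Finset.mem_image_of_mem p
        (Finset.mem_filter.2 ⟨Finset.mem_univ _, SameCycle.refl α i.1⟩)
    · exact Finset.mem_image_of_mem p
        (Finset.mem_filter.2
          ⟨Finset.mem_univ _, sameCycle_apply_right.2 (SameCycle.refl α i.1)⟩)

theorem exists_isTransversal_pair {V : Type*} {p : X → V} {α β : Perm X}
    (hα : Set.InjOn p {x | α x ≠ x}) (hβ : Set.InjOn p {x | β x ≠ x}) {w b : X}
    (hw : α w ≠ w) (hb : β b ≠ b) (hwb : p w = p b) :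
    ∃ R S : Finset X, IsTransversal α R ∧ IsTransversal β S ∧ α⁻¹ w ∈ R ∧ b ∈ S ∧
      Set.InjOn p ((R : Set X) ∪ S) := by
  classical
  obtain ⟨R, hR⟩ := exists_isTransversal α
  obtain ⟨S, hS⟩ := exists_isTransversal β
  set a := α⁻¹ w with ha_def
  have haw : SameCycle α a w := ⟨1, by simp [ha_def]⟩
  have ha : α a ≠ a := apply_ne_of_sameCycle haw.symm hw
  have hab : p a ≠ p b := fun h => by
    have := hα ha hw (h.trans hwb.symm)
    rw [this] at ha_def
    exact hw (Perm.eq_inv_iff_eq.1 ha_def)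
  have hnotR : ∀ (i : {x // x ∈ R ∧ ¬ SameCycle α a x}) (x y : X), SameCycle α a y →
      SameCycle α i x → p x ≠ p y := fun i x y hy hx h => by
    have := hα (apply_ne_of_sameCycle hx (hR.apply_ne i i.2.1)) (apply_ne_of_sameCycle hy ha) h
    subst this
    exact i.2.2 (hy.trans hx.symm)
  have hnotS : ∀ (i : {x // x ∈ S ∧ ¬ SameCycle β b x}) (x : X),
      SameCycle β i x → p x ≠ p b := fun i x hx h => by
    have := hβ (apply_ne_of_sameCycle hx (hS.apply_ne i i.2.1)) hb h
    subst this
    exact i.2.2 hx.symm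
  obtain ⟨hs, hs2⟩ := hR.image_classes hα a
  obtain ⟨ht, ht2⟩ := hS.image_classes hβ b
  obtain ⟨f, hf, hfs, hft⟩ := exists_injective_of_two_disjoint_families _ _ hs ht hs2 ht2 (p a)
  simp only [Finset.mem_image, Finset.mem_filter, Finset.mem_univ, true_and] at hfs hft
  choose g hg hgf using hfs
  choose hex hne using hft
  choose k hk hkf using hex
  refine ⟨_, _, hR.insert_image ha g hg, hS.insert_image hb k hk, Finset.mem_insert_self _ _,
    Finset.mem_insert_self _ _, ?_⟩
  have e1 : ∀ i, p (g i) ≠ p a := fun i => hnotR i _ a (SameCycle.refl _ _) (hg i)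
  have e2 : ∀ i, p (g i) ≠ p b := fun i => hwb ▸ hnotR i _ w haw (hg i)
  have e3 : ∀ j, p (k j) ≠ p b := fun j => hnotS j _ (hk j)
  have e4 : ∀ j, p (k j) ≠ p a := fun j => hkf j ▸ hne j
  have e5 : ∀ i i', p (g i) = p (g i') → i = i' := fun i i' h =>
    Sum.inl_injective (hf (by rw [← hgf, ← hgf, h]))
  have e6 : ∀ i i', p (k i) = p (k i') → i = i' := fun i i' h =>
    Sum.inr_injective (hf (by rw [← hkf, ← hkf, h]))
  have e7 : ∀ i j, p (g i) ≠ p (k j) := fun i j h =>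
    Sum.inl_ne_inr (hf (by rw [← hgf, ← hkf, h]))
  intro x hx y hy hxy
  simp only [Finset.coe_insert, Set.coe_toFinset, Set.mem_union, Set.mem_insert_iff,
    Set.mem_range] at hx hy
  rcases hx with (rfl | ⟨i, rfl⟩) | (rfl | ⟨i, rfl⟩) <;>
    rcases hy with (rfl | ⟨j, rfl⟩) | (rfl | ⟨j, rfl⟩) <;> grind

end Transversals

section Decomposability

variable {m n : ℕ} {p q : Fin m → Fin n}

/-- There is a `p`-cycle decomposition of `(p, q)` of length at most `d` whose product fixes the
points at which `p` and `q` agree. -/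
def IsDecomposable (p q : Fin m → Fin n) (d : ℕ) : Prop :=
  ∃ L : List (Perm (Fin m)), L.length ≤ d ∧ (∀ σ ∈ L, IsPCycle p σ) ∧ q = p ∘ ⇑L.prod ∧
    ∀ x, q x = p x → L.prod x = x

theorem IsDecomposable.mono {d e : ℕ} (h : IsDecomposable p q d) (hde : d ≤ e) :
    IsDecomposable p q e := by
  obtain ⟨L, hL, h⟩ := h
  exact ⟨L, hL.trans hde, h⟩

theorem isDecomposable_self : IsDecomposable p p 0 := ⟨[], by simp, by simp, by simp, by simp⟩

theorem IsBalanced.apply_eq {α : Perm (Fin m)} (hα : IsBalanced p α) {x : Fin m}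
    (h : p (α x) = p x) : α x = x := by
  by_contra hx
  exact hx (hα (fun h' => hx (α.injective h')) hx h)

theorem IsCycleWithin.isPCycle {f : Perm (Fin m)} {S : Set (Fin m)} (hf : IsCycleWithin f S)
    (hS : Set.InjOn p S) : IsPCycle p f := by
  refine ⟨hS.mono fun x hx => ?_, hf.eq_one_or_isCycle⟩
  by_contra hxS
  exact hx (hf.1 x hxS)

theorem IsPCycle.inv {f : Perm (Fin m)} (hf : IsPCycle p f) : IsPCycle p f⁻¹ := by
  refine ⟨hf.1.mono fun x hx => ?_, hf.2.imp (by rintro rfl; simp) IsCycle.inv⟩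
  exact fun h => hx (Perm.inv_eq_iff_eq.2 h.symm)

theorem IsPCycle.conj {f h : Perm (Fin m)} (hf : IsPCycle p f) (hh : ∀ x, p (h x) = p x) :
    IsPCycle p (h * f * h⁻¹) := by
  refine ⟨?_, hf.2.imp (by rintro rfl; simp) IsCycle.conj⟩
  have hh' : ∀ x, p (h⁻¹ x) = p x := fun x => by simpa using (hh (h⁻¹ x)).symm
  have hmem : ∀ x ∈ psupp (h * f * h⁻¹), h⁻¹ x ∈ psupp f := fun x hx hfx =>
    hx (by rw [Perm.mul_apply, Perm.mul_apply, hfx]; simp)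
  intro x hx y hy hxy
  exact h⁻¹.injective (hf.1 (hmem x hx) (hmem y hy) (by rw [hh', hh', hxy]))

theorem IsPCycle.isDecomposable {σ : Perm (Fin m)} (hσ : IsPCycle p σ) :
    IsDecomposable p (p ∘ σ) 1 :=
  ⟨[σ], by simp, by simpa using hσ, by simp, fun x hx => by simpa using hσ.1.apply_eq hx⟩

theorem IsBalanced.isDecomposable {α : Perm (Fin m)} (hα : IsBalanced p α) :
    IsDecomposable p (p ∘ α) 2 := by
  obtain ⟨R, hR⟩ := exists_isTransversal α
  rcases R.eq_empty_or_nonempty with rfl | hne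
  · have : α = 1 := by
      ext x
      by_contra hx
      obtain ⟨r, hr, -⟩ := hR.exists_sameCycle x fun h => hx (by simp [h])
      simp at hr
    subst this
    exact isDecomposable_self.mono (by simp)
  obtain ⟨γ, hγ, hαγ⟩ := exists_joining_cycle_of_transversal α R hne hR.apply_ne
    hR.eq_of_sameCycle hR.exists_sameCycle
  refine ⟨[α * γ, γ⁻¹], by simp, ?_, by simp [mul_assoc], fun x hx => ?_⟩
  · simp only [List.mem_cons, List.not_mem_nil, or_false, forall_eq_or_imp, forall_eq]
    exact ⟨hαγ.isPCycle hα, (hγ.isPCycle (hα.mono hR.apply_ne)).inv⟩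
  · simpa [mul_assoc] using hα.apply_eq hx

/-- Two disjoint `p`-balanced permutations can be performed with three `p`-cycles. -/
theorem IsBalanced.isDecomposable_mul {α β : Perm (Fin m)} (hα : IsBalanced p α)
    (hβ : IsBalanced p β) (hαβ : Perm.Disjoint α β) : IsDecomposable p (p ∘ ⇑(α * β)) 3 := by
  by_cases hcommon : ∃ w b, α w ≠ w ∧ β b ≠ b ∧ p w = p b
  swap
  · push Not at hcommon
    refine IsDecomposable.mono (IsBalanced.isDecomposable ?_) (by norm_num)
    have hmem : ∀ x, x ∈ psupp (α * β) → α x ≠ x ∨ β x ≠ x := fun x hx => by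
      by_contra! h
      exact hx (by simp [Perm.mul_apply, h.1, h.2])
    intro x hx y hy hxy
    rcases hmem x hx with hx | hx <;> rcases hmem y hy with hy | hy
    · exact hα hx hy hxy
    · exact absurd hxy (hcommon x y hx hy)
    · exact absurd hxy.symm (hcommon y x hy hx)
    · exact hβ hx hy hxy
  obtain ⟨w, b, hw, hb, hwb⟩ := hcommon
  obtain ⟨R, S, hR, hS, hwR, hbS, hRS⟩ := exists_isTransversal_pair hα hβ hw hb hwb
  obtain ⟨γ, hγ, hαγ⟩ := exists_joining_cycle_of_transversal α R ⟨_, hwR⟩ hR.apply_ne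
    hR.eq_of_sameCycle hR.exists_sameCycle
  obtain ⟨δ, hδ, hβδ⟩ := exists_joining_cycle_of_transversal β S ⟨_, hbS⟩ hS.apply_ne
    hS.eq_of_sameCycle hS.exists_sameCycle
  have hsupp : ∀ x, α x ≠ x → β x = x := fun x hx => (hαβ x).resolve_left hx
  have hsupp' : ∀ x, β x ≠ x → α x = x := fun x hx => (hαβ x).resolve_right hx
  have hdisjRS : _root_.Disjoint (R : Set (Fin m)) S := Set.disjoint_left.2 fun x hx hy =>
    hS.apply_ne x hy (hsupp x (hR.apply_ne x hx))
  have hδS : δ b ∈ S := by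
    by_contra h
    have h2 : δ b = b := δ.injective (hδ.1 _ h)
    exact h (h2.symm ▸ hbS)
  have hτ := hγ.swap_mul_mul hδ hdisjRS (Finset.mem_coe.2 hwR) (Finset.mem_coe.2 hδS)
  set τ := swap (α⁻¹ w) (δ b) * (γ * δ) with hτ_def
  set h := swap w b with h_def
  have hph : ∀ x, p (h x) = p x := fun x => by
    rw [h_def, swap_apply_def]
    split_ifs with h1 h2
    · rw [h1, hwb]
    · rw [h2, hwb]
    · rfl
  have hcomm : Commute δ α := Perm.Disjoint.commute fun x => by
    by_cases hx : α x = x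
    · exact Or.inr hx
    · exact Or.inl (hδ.1 x fun hxS => hS.apply_ne x hxS (hsupp x hx))
  have hγδ : Commute γ δ := Perm.Disjoint.commute fun x => by
    by_cases hx : x ∈ R
    · exact Or.inr (hδ.1 x (Set.disjoint_left.1 hdisjRS (Finset.mem_coe.2 hx)))
    · exact Or.inl (hγ.1 x hx)
  have hγb : γ b = b := hγ.1 b (Set.disjoint_right.1 hdisjRS (Finset.mem_coe.2 hbS))
  have hαδb : α (δ b) = δ b := hsupp' _ (hS.apply_ne _ hδS)
  have hατ : α * τ = δ * h * (α * γ) := by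
    have h1 : swap (α⁻¹ w) (δ b) = δ * swap (α⁻¹ w) b * δ⁻¹ := by
      rw [← swap_apply_apply, hδ.1 _ (Set.disjoint_left.1 hdisjRS (Finset.mem_coe.2 hwR))]
    have h2 : swap (α⁻¹ w) b = α⁻¹ * h * α := by
      have hb' : α⁻¹ b = b := Perm.inv_eq_iff_eq.2 (hsupp' b hb).symm
      have := swap_apply_apply α⁻¹ w b
      rw [hb', inv_inv] at this
      exact this
    calc α * τ = (α * δ) * α⁻¹ * h * α * (δ⁻¹ * (γ * δ)) := by
          rw [hτ_def, h1, h2]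
          simp only [mul_assoc]
      _ = (δ * α) * α⁻¹ * h * α * (δ⁻¹ * (δ * γ)) := by rw [hcomm.eq, hγδ.eq]
      _ = δ * h * (α * γ) := by simp [mul_assoc]
  have hprod : (h * (β * δ) * h⁻¹) * ((α * γ) * (τ⁻¹ * 1)) = h * (α * β) := by
    have hh : h⁻¹ = h := swap_inv w b
    calc (h * (β * δ) * h⁻¹) * ((α * γ) * (τ⁻¹ * 1))
        = h * β * (δ * h * (α * γ)) * τ⁻¹ := by rw [hh, mul_one]; simp only [mul_assoc]
      _ = h * (β * α) := by rw [← hατ]; simp [mul_assoc]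
      _ = h * (α * β) := by rw [hαβ.commute.eq]
  refine ⟨[h * (β * δ) * h⁻¹, α * γ, τ⁻¹], by simp, ?_, ?_, fun x hx => ?_⟩
  · simp only [List.mem_cons, List.not_mem_nil, or_false, forall_eq_or_imp, forall_eq]
    exact ⟨(hβδ.isPCycle hβ).conj hph, hαγ.isPCycle hα, (hτ.isPCycle hRS).inv⟩
  · simp only [List.prod_cons, List.prod_nil]
    rw [hprod]
    ext x
    simp [hph]
  · simp only [List.prod_cons, List.prod_nil]
    rw [hprod]
    have hfix : α x = x ∧ β x = x := by
      by_cases h1 : β x = x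
      · simp only [Function.comp_apply, Perm.mul_apply, h1] at hx
        exact ⟨hα.apply_eq hx, h1⟩
      · have h2 : α (β x) = β x := hsupp' _ fun h' => h1 (β.injective h')
        simp only [Function.comp_apply, Perm.mul_apply, h2] at hx
        exact absurd (hβ.apply_eq hx) h1
    rw [Perm.mul_apply, Perm.mul_apply, hfix.2, hfix.1, h_def]
    refine swap_apply_of_ne_of_ne ?_ ?_
    · rintro rfl
      exact hw hfix.1
    · rintro rfl
      exact hb hfix.2

/-- If `α` brings a set of items to their destinations in `q`, then `(p, q)` can be solved by first
dealing with these items, and then with the remaining ones. -/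
theorem IsDecomposable.add {α : Perm (Fin m)} {d e : ℕ}
    (hα : ∀ x, α x ≠ x → q x ≠ p x ∧ p (α x) = q x) (h1 : IsDecomposable p (p ∘ α) d)
    (h2 : IsDecomposable p (q ∘ ⇑α⁻¹) e) : IsDecomposable p q (d + e) := by
  obtain ⟨L, hL, hLp, hLq, hLfix⟩ := h1
  obtain ⟨M, hM, hMp, hMq, hMfix⟩ := h2
  have hLq' : ∀ x, p (α x) = p (L.prod x) := congrFun hLq
  have hMq' : ∀ x, q (α⁻¹ x) = p (M.prod x) := congrFun hMq
  have hMsupp : ∀ x, α x ≠ x → M.prod x = x := fun x hx => by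
    refine hMfix x ?_
    have hx' : α (α⁻¹ x) ≠ α⁻¹ x := by
      intro h
      exact hx (Perm.eq_inv_iff_eq.1 ((Equiv.apply_symm_apply α x).symm.trans h))
    simpa using (hα _ hx').2.symm
  have hMimage : ∀ x, α x = x → α (M.prod x) = M.prod x := fun x hx => by
    by_contra h
    exact h (by rw [M.prod.injective (hMsupp _ h), hx])
  have hLsupp : ∀ x, α x = x → L.prod x = x := fun x hx => hLfix x (by simp [hx])
  refine ⟨L ++ M, by simpa using Nat.add_le_add hL hM, ?_, ?_, fun x hx => ?_⟩
  · intro σ hσ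
    exact (List.mem_append.1 hσ).elim (hLp σ) (hMp σ)
  · ext1 x
    rw [List.prod_append, Function.comp_apply, Perm.mul_apply]
    by_cases hx : α x = x
    · rw [hLsupp _ (hMimage x hx), ← hMq', Perm.inv_eq_iff_eq.2 hx.symm]
    · rw [hMsupp x hx, ← hLq', (hα x hx).2]
  · have hαx : α x = x := by
      by_contra h
      exact (hα x h).1 hx
    rw [List.prod_append, Perm.mul_apply, hMfix x, hLsupp x hαx]
    rw [Function.comp_apply, Perm.inv_eq_iff_eq.2 hαx.symm, hx]

end Decomposability

section Factors

variable {m n : ℕ} {p q : Fin m → Fin n}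

/-- The number of items which lie in the part `v` of `p`, but in a different part of `q`. -/
def excess (p q : Fin m → Fin n) (v : Fin n) : ℕ :=
  (Finset.univ.filter fun x => q x ≠ p x ∧ p x = v).card

theorem card_filter_eq_excess (h : ∀ v, fiberCard p v = fiberCard q v) (v : Fin n) :
    (Finset.univ.filter fun x => q x ≠ p x ∧ q x = v).card = excess p q v := by
  have h1 := Finset.card_filter_add_card_filter_not (s := Finset.univ.filter fun x => p x = v)
    (p := fun x => q x = p x)
  have h2 := Finset.card_filter_add_card_filter_not (s := Finset.univ.filter fun x => q x = v)
    (p := fun x => q x = p x)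
  have hv := h v
  unfold fiberCard at hv
  simp only [Finset.filter_filter] at h1 h2
  have h3 : (Finset.univ.filter fun x => p x = v ∧ q x = p x) =
      Finset.univ.filter fun x => q x = v ∧ q x = p x := by
    ext x
    simp only [Finset.mem_filter, Finset.mem_univ, true_and]
    exact ⟨fun h => ⟨h.2.trans h.1, h.2⟩, fun h => ⟨h.2.symm.trans h.1, h.2⟩⟩
  rw [h3] at h1
  simp only [excess, and_comm (a := ¬ q _ = p _), ne_eq]
  omega

theorem exists_perm_of_excess_le (h : ∀ v, fiberCard p v = fiberCard q v) {k : ℕ}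
    (hk : ∀ v, excess p q v ≤ k + 1) :
    ∃ τ : Perm (Fin n), ∀ v, (∃ x, q x ≠ p x ∧ p x = v ∧ q x = τ v) ∨
      (v = τ v ∧ excess p q v ≤ k) := by
  classical
  let N : Fin n → Finset (Fin n) := fun v => Finset.univ.filter fun u =>
    (∃ x, q x ≠ p x ∧ p x = v ∧ q x = u) ∨ (v = u ∧ excess p q v ≤ k)
  obtain ⟨f, hf, hfN⟩ := (Finset.all_card_le_biUnion_card_iff_exists_injective N).1 (by
    intro A
    have h1 : ∑ v ∈ A, excess p q v ≤ ∑ v ∈ A.biUnion N, excess p q v := by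
      calc ∑ v ∈ A, excess p q v
          = (Finset.univ.filter fun x => q x ≠ p x ∧ p x ∈ A).card := by
            rw [Finset.card_eq_sum_card_fiberwise (f := p) (t := A)]
            · refine Finset.sum_congr rfl fun v hv => ?_
              rw [excess, Finset.filter_filter]
              congr 1
              ext x
              simp only [Finset.mem_filter, Finset.mem_univ, true_and]
              exact ⟨fun h => ⟨⟨h.1, h.2 ▸ hv⟩, h.2⟩, fun h => ⟨h.1.1, h.2⟩⟩
            · intro x hx
              simpa using (Finset.mem_filter.1 (Finset.mem_coe.1 hx)).2.2
        _ ≤ (Finset.univ.filter fun x => q x ≠ p x ∧ q x ∈ A.biUnion N).card := by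
            refine Finset.card_le_card fun x hx => ?_
            simp only [Finset.mem_filter, Finset.mem_univ, true_and] at hx ⊢
            refine ⟨hx.1, Finset.mem_biUnion.2 ⟨p x, hx.2, ?_⟩⟩
            simp only [N, Finset.mem_filter, Finset.mem_univ, true_and]
            exact Or.inl ⟨x, hx.1, rfl, rfl⟩
        _ = ∑ v ∈ A.biUnion N, excess p q v := by
            rw [Finset.card_eq_sum_card_fiberwise (f := q) (t := A.biUnion N)]
            · refine Finset.sum_congr rfl fun v hv => ?_
              rw [← card_filter_eq_excess h, Finset.filter_filter]
              congr 1
              ext x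
              simp only [Finset.mem_filter, Finset.mem_univ, true_and]
              exact ⟨fun h => ⟨h.1.1, h.2⟩, fun h => ⟨⟨h.1, h.2 ▸ hv⟩, h.2⟩⟩
            · intro x hx
              exact (Finset.mem_filter.1 (Finset.mem_coe.1 hx)).2.2
    have h2 : ∑ v ∈ A, (k + 1 - excess p q v) ≤ ∑ v ∈ A.biUnion N, (k + 1 - excess p q v) := by
      refine Finset.sum_le_sum_of_ne_zero fun v hv hne => Finset.mem_biUnion.2 ⟨v, hv, ?_⟩
      simp only [N, Finset.mem_filter, Finset.mem_univ, true_and]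
      exact Or.inr (by omega)
    have hsum : ∀ B : Finset (Fin n),
        ∑ v ∈ B, excess p q v + ∑ v ∈ B, (k + 1 - excess p q v) = B.card * (k + 1) := by
      intro B
      rw [← Finset.sum_add_distrib, Finset.sum_congr rfl fun v _ => Nat.add_sub_cancel' (hk v)]
      simp
    have := hsum A
    have := hsum (A.biUnion N)
    refine Nat.le_of_mul_le_mul_right (?_ : A.card * (k + 1) ≤ _ * (k + 1)) k.succ_pos
    omega)
  refine ⟨Equiv.ofBijective f (Finite.injective_iff_bijective.1 hf), fun v => ?_⟩
  simpa [N] using hfN v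

/-- Some balanced permutation brings items to their destinations in `q`, one from each part of
maximal excess. -/
theorem exists_isBalanced_of_excess_le (h : ∀ v, fiberCard p v = fiberCard q v) {k : ℕ}
    (hk : ∀ v, excess p q v ≤ k + 1) :
    ∃ α : Perm (Fin m), IsBalanced p α ∧ (∀ x, α x ≠ x → q x ≠ p x ∧ p (α x) = q x) ∧
      ∀ v, excess p q v = k + 1 → ∃ x, α x ≠ x ∧ p x = v := by
  obtain ⟨τ, hτ⟩ := exists_perm_of_excess_le h hk
  have hex : ∀ v : {v // τ v ≠ v}, ∃ x, q x ≠ p x ∧ p x = v ∧ q x = τ v := fun v =>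
    (hτ v).resolve_right fun h => v.2 h.1.symm
  choose e he hpe hqe using hex
  have hinj : Function.Injective e := fun v w hvw => Subtype.ext (by rw [← hpe, ← hpe, hvw])
  let τ' : Perm {v // τ v ≠ v} := τ.subtypePerm fun v => by simp
  let α := τ'.viaEmbedding ⟨e, hinj⟩
  have hαe : ∀ v, α (e v) = e (τ' v) := fun v => τ'.viaEmbedding_apply ⟨e, hinj⟩ v
  have hmem : ∀ x, α x ≠ x → ∃ v, e v = x := fun x hx => by
    by_contra hc
    exact hx (τ'.viaEmbedding_apply_of_notMem ⟨e, hinj⟩ x hc)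
  refine ⟨α, ?_, ?_, ?_⟩
  · intro x hx y hy hxy
    obtain ⟨v, rfl⟩ := hmem x hx
    obtain ⟨w, rfl⟩ := hmem y hy
    rw [hpe, hpe] at hxy
    rw [Subtype.ext hxy]
  · intro x hx
    obtain ⟨v, rfl⟩ := hmem x hx
    refine ⟨he v, ?_⟩
    rw [hαe, hpe, hqe]
    rfl
  · intro v hv
    have hv' : τ v ≠ v := fun h' => by
      rcases hτ v with ⟨x, h1, h2, h3⟩ | h1
      · exact h1 (by rw [h3, h2, h'])
      · omega
    refine ⟨e ⟨v, hv'⟩, ?_, hpe _⟩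
    rw [hαe]
    exact fun h' => hv' (congrArg Subtype.val (hinj h'))

theorem fiberCard_comp_perm (α : Perm (Fin m)) (v : Fin n) :
    fiberCard (q ∘ α) v = fiberCard q v :=
  Finset.card_equiv α (by simp)

theorem ne_of_comp_inv_ne {α : Perm (Fin m)} (hα : ∀ x, α x ≠ x → q x ≠ p x ∧ p (α x) = q x)
    {x : Fin m} (hx : q (α⁻¹ x) ≠ p x) : α x = x ∧ q x ≠ p x := by
  have h1 : α⁻¹ x = x := by
    by_contra h
    have h2 := (hα (α⁻¹ x) fun h' => h (((Equiv.apply_symm_apply α x).symm.trans h').symm)).2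
    exact hx (h2.symm.trans (congrArg p (Equiv.apply_symm_apply α x)))
  rw [h1] at hx
  exact ⟨(Perm.inv_eq_iff_eq.1 h1).symm, hx⟩

theorem excess_comp_inv_le {α : Perm (Fin m)}
    (hα : ∀ x, α x ≠ x → q x ≠ p x ∧ p (α x) = q x) (v : Fin n) :
    excess p (q ∘ ⇑α⁻¹) v ≤ excess p q v := by
  refine Finset.card_le_card fun x hx => ?_
  obtain ⟨h1, h2⟩ := (Finset.mem_filter.1 hx).2
  exact Finset.mem_filter.2 ⟨Finset.mem_univ x, (ne_of_comp_inv_ne hα h1).2, h2⟩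

theorem excess_comp_inv_lt {α : Perm (Fin m)}
    (hα : ∀ x, α x ≠ x → q x ≠ p x ∧ p (α x) = q x) {x : Fin m} (hx : α x ≠ x) :
    excess p (q ∘ ⇑α⁻¹) (p x) < excess p q (p x) := by
  refine Finset.card_lt_card (Finset.ssubset_iff_of_subset (fun y hy => ?_) |>.2 ⟨x, ?_, ?_⟩)
  · obtain ⟨h1, h2⟩ := (Finset.mem_filter.1 hy).2
    exact Finset.mem_filter.2 ⟨Finset.mem_univ y, (ne_of_comp_inv_ne hα h1).2, h2⟩
  · exact Finset.mem_filter.2 ⟨Finset.mem_univ x, (hα x hx).1, rfl⟩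
  · intro h
    exact hx (ne_of_comp_inv_ne hα (Finset.mem_filter.1 h).2.1).1

theorem exists_isBalanced_excess_comp_inv_le (h : ∀ v, fiberCard p v = fiberCard q v) {k : ℕ}
    (hk : ∀ v, excess p q v ≤ k + 1) :
    ∃ α : Perm (Fin m), IsBalanced p α ∧ (∀ x, α x ≠ x → q x ≠ p x ∧ p (α x) = q x) ∧
      ∀ v, excess p (q ∘ ⇑α⁻¹) v ≤ k := by
  obtain ⟨α, hα, hαq, hcov⟩ := exists_isBalanced_of_excess_le h hk
  refine ⟨α, hα, hαq, fun v => ?_⟩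
  rcases (hk v).lt_or_eq with hlt | heq
  · exact (excess_comp_inv_le hαq v).trans (Nat.le_of_lt_succ hlt)
  · obtain ⟨x, hx, rfl⟩ := hcov v heq
    have := excess_comp_inv_lt hαq hx
    omega

theorem eq_of_excess_le_zero (hk : ∀ v, excess p q v ≤ 0) : q = p := by
  funext x
  by_contra hx
  have h0 := Finset.card_eq_zero.1 (Nat.le_zero.1 (hk (p x)))
  exact Finset.notMem_empty x (h0 ▸ Finset.mem_filter.2 ⟨Finset.mem_univ x, hx, rfl⟩)

theorem isDecomposable_of_excess_le (k : ℕ) (h : ∀ v, fiberCard p v = fiberCard q v)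
    (hk : ∀ v, excess p q v ≤ k) : IsDecomposable p q ((3 * k + 1) / 2) := by
  induction k using Nat.twoStepInduction generalizing q with
  | zero =>
    rw [eq_of_excess_le_zero hk]
    exact isDecomposable_self.mono (Nat.zero_le _)
  | one =>
    obtain ⟨α, hα, hαq, hα0⟩ := exists_isBalanced_excess_comp_inv_le h hk
    refine (IsDecomposable.add hαq hα.isDecomposable (e := 0) ?_)
    rw [eq_of_excess_le_zero hα0]
    exact isDecomposable_self
  | more k ih _ =>
    obtain ⟨α, hα, hαq, hαk⟩ := exists_isBalanced_excess_comp_inv_le (k := k + 1) h hk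
    have hα' : ∀ v, fiberCard p v = fiberCard (q ∘ ⇑α⁻¹) v := fun v => by
      rw [fiberCard_comp_perm, h]
    obtain ⟨β, hβ, hβq, hβk⟩ := exists_isBalanced_excess_comp_inv_le hα' hαk
    have hαβ : ∀ x, β x ≠ x → α x = x ∧ q x ≠ p x := fun x hx =>
      ne_of_comp_inv_ne hαq (hβq x hx).1
    have hdisj : Perm.Disjoint β α := fun x => by
      by_cases hx : β x = x
      · exact Or.inl hx
      · exact Or.inr (hαβ x hx).1
    have hβαq : ∀ x, (β * α) x ≠ x → q x ≠ p x ∧ p ((β * α) x) = q x := fun x hx => by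
      by_cases hβx : β x = x
      · have hαx : α x ≠ x := fun h' => hx (by rw [Perm.mul_apply, h', hβx])
        have hβα : β (α x) = α x := (hdisj (α x)).resolve_right fun h' => hαx (α.injective h')
        rw [Perm.mul_apply, hβα]
        exact hαq x hαx
      · obtain ⟨hαx, hne⟩ := hαβ x hβx
        refine ⟨hne, ?_⟩
        rw [Perm.mul_apply, hαx, (hβq x hβx).2, Function.comp_apply,
          Perm.inv_eq_iff_eq.2 hαx.symm]
    have hcomp : q ∘ ⇑(β * α)⁻¹ = (q ∘ ⇑α⁻¹) ∘ ⇑β⁻¹ := by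
      rw [mul_inv_rev, Perm.coe_mul, Function.comp_assoc]
    refine ((hβ.isDecomposable_mul hα hdisj).add hβαq (e := (3 * k + 1) / 2) ?_).mono (by omega)
    rw [hcomp]
    exact ih (fun v => by rw [fiberCard_comp_perm, hα']) hβk

theorem isDecomposable_of_excess_le_of_ne (k j : ℕ) (u : Fin n)
    (h : ∀ v, fiberCard p v = fiberCard q v) (hk : ∀ v, v ≠ u → excess p q v ≤ k)
    (hu : excess p q u ≤ k + j) : IsDecomposable p q (j + (3 * k + 1) / 2) := by
  induction j generalizing q with
  | zero =>
    refine (isDecomposable_of_excess_le k h fun v => ?_).mono (by omega)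
    by_cases hv : v = u
    · exact hv ▸ hu
    · exact hk v hv
  | succ j ih =>
    rcases hu.lt_or_eq with hlt | heq
    · exact (ih h hk (by omega)).mono (by omega)
    obtain ⟨α, hα, hαq, hcov⟩ := exists_isBalanced_of_excess_le (k := k + j) h fun v => by
      by_cases hv : v = u
      · exact hv ▸ hu
      · exact (hk v hv).trans (by omega)
    obtain ⟨x, hx, rfl⟩ := hcov u heq
    have hσα : ∀ y, α.cycleOf x y ≠ y → α.cycleOf x y = α y ∧ α y ≠ y := fun y hy => by
      have hxy : SameCycle α x y := by
        by_contra hc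
        exact hy (cycleOf_apply_of_not_sameCycle hc)
      have := hxy.cycleOf_apply
      exact ⟨this, this ▸ hy⟩
    have hσ : IsPCycle p (α.cycleOf x) :=
      ⟨hα.mono fun y hy => (hσα y hy).2, Or.inr (isCycle_cycleOf α hx)⟩
    have hσq : ∀ y, α.cycleOf x y ≠ y → q y ≠ p y ∧ p (α.cycleOf x y) = q y := fun y hy => by
      rw [(hσα y hy).1]
      exact hαq y (hσα y hy).2
    have hσx : α.cycleOf x x ≠ x := by rwa [cycleOf_apply_self]
    refine (hσ.isDecomposable.add hσq (e := j + (3 * k + 1) / 2) (ih ?_ ?_ ?_)).mono (by omega)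
    · exact fun v => by rw [fiberCard_comp_perm, h]
    · exact fun v hv => (excess_comp_inv_le hσq v).trans (hk v hv)
    · have := excess_comp_inv_lt hσq hσx
      omega

end Factors

/-- The diameter of the partition polytope `PP(κ₁, …, κₙ)` is at most
`κ₁ + ⌈κ₂/2⌉`: any two partitions of the same nonincreasing shape `κ` are
related by a `p`-cycle decomposition of length at most `κ₁ + ⌈κ₂/2⌉`. -/
theorem partition_polytope_diameter_upper_bound
    (m n : ℕ) (hn : 2 ≤ n) (κ : Fin n → ℕ) (hmono : Antitone κ)
    (hsum : ∑ i, κ i = m) (p p' : Fin m → Fin n)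
    (hp : ∀ i, fiberCard p i = κ i) (hp' : ∀ i, fiberCard p' i = κ i) :
    ∃ L : List (Equiv.Perm (Fin m)),
      L.length ≤ κ ⟨0, by omega⟩ + (κ ⟨1, by omega⟩ + 1) / 2 ∧
      (∀ σ ∈ L, IsPCycle p σ) ∧ p' = p ∘ ⇑L.prod := by
  have hexcess : ∀ v, excess p p' v ≤ κ v := fun v => by
    rw [← hp v]
    exact Finset.card_le_card fun x hx =>
      Finset.mem_filter.2 ⟨Finset.mem_univ x, (Finset.mem_filter.1 hx).2.2⟩
  have h01 : κ ⟨1, by omega⟩ ≤ κ ⟨0, by omega⟩ := hmono (Fin.mk_le_mk.2 zero_le_one)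
  obtain ⟨L, hL, hLp, hLq, -⟩ := isDecomposable_of_excess_le_of_ne (κ ⟨1, by omega⟩)
    (κ ⟨0, by omega⟩ - κ ⟨1, by omega⟩) ⟨0, by omega⟩ (fun v => (hp v).trans (hp' v).symm)
    (fun v hv => (hexcess v).trans (hmono (Fin.mk_le_of_le_val
      (Nat.one_le_iff_ne_zero.2 fun h => hv (Fin.ext h)))))
    ((hexcess _).trans (by omega))
  exact ⟨L, by omega, hLp, hLq⟩
end

section
/- Let p, p' : Fin m → Fin n be two (m,n)-partitions with |p⁻¹(i)| = |p'⁻¹(i)| for every i ∈ Fin n, and suppose every fiber of p has size at most 2. Then there exists a p-cycle decomposition of (p, p') of length at most 3; that is, there exist p-cycles σ₁, σ₂, σ₃ of Fin m with p' = p ∘ σ₃ ∘ σ₂ ∘ σ₁. (Equivalently, if κ₁ ≥ ⋯ ≥ κₙ are nonnegative integers with κ₁ = 2, the partition polytope PP(κ₁, …, κₙ) has combinatorial diameter at most 3.) -/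
/-- `f` moves only points of `S`, and permutes `S` in a single cycle. -/
def CyclicOn {X : Type*} (f : Equiv.Perm X) (S : Set X) : Prop :=
  (∀ x, f x ≠ x → x ∈ S) ∧ ∀ x ∈ S, ∀ y ∈ S, f.SameCycle x y

namespace CyclicOn

variable {X : Type*} {f g : Equiv.Perm X} {S T : Set X}

lemma one (x : X) : CyclicOn (1 : Equiv.Perm X) {x} := by
  refine ⟨fun y hy => absurd rfl hy, ?_⟩
  rintro y rfl z rfl
  exact Equiv.Perm.SameCycle.refl _ _

lemma swap [DecidableEq X] (x y : X) : CyclicOn (Equiv.swap x y) {x, y} := by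
  have hxy : (Equiv.swap x y).SameCycle x y := ⟨1, by simp⟩
  refine ⟨fun z hz => ?_, ?_⟩
  · by_contra h
    simp only [Set.mem_insert_iff, Set.mem_singleton_iff, not_or] at h
    exact hz (Equiv.swap_apply_of_ne_of_ne h.1 h.2)
  · rintro z (rfl | rfl) t (rfl | rfl)
    · exact Equiv.Perm.SameCycle.refl _ _
    · exact hxy
    · exact hxy.symm
    · exact Equiv.Perm.SameCycle.refl _ _

lemma of_isCycle (hf : f.IsCycle) : CyclicOn f {x | f x ≠ x} :=
  ⟨fun _ hx => hx, fun _ hx _ hy => hf.sameCycle hx hy⟩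

lemma cycleOf [Fintype X] [DecidableEq X] (f : Equiv.Perm X) (a : X) :
    CyclicOn (f.cycleOf a) {x | f.SameCycle a x} := by
  refine ⟨fun x hx => ?_, fun x hx y hy => ?_⟩
  · by_contra h
    exact hx (Equiv.Perm.cycleOf_apply_of_not_sameCycle h)
  · have key : ∀ z, f.SameCycle a z → (f.cycleOf a).SameCycle a z := by
      rintro z ⟨i, rfl⟩
      exact ⟨i, Equiv.Perm.cycleOf_zpow_apply_self f a i⟩
    exact (key x hx).symm.trans (key y hy)

lemma inv (hf : CyclicOn f S) : CyclicOn f⁻¹ S := by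
  refine ⟨fun x hx => hf.1 x fun h => hx ?_, fun x hx y hy => ?_⟩
  · rw [Equiv.Perm.inv_eq_iff_eq, h]
  · exact Equiv.Perm.sameCycle_inv.2 (hf.2 x hx y hy)

lemma conj (hf : CyclicOn f S) (g : Equiv.Perm X) : CyclicOn (g * f * g⁻¹) (g '' S) := by
  refine ⟨fun x hx => ⟨g⁻¹ x, hf.1 _ fun h => hx ?_, by simp⟩, ?_⟩
  · rw [Equiv.Perm.mul_apply, Equiv.Perm.mul_apply, h, ← Equiv.Perm.mul_apply, mul_inv_cancel,
      Equiv.Perm.one_apply]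
  · rintro _ ⟨x, hx, rfl⟩ _ ⟨y, hy, rfl⟩
    rw [Equiv.Perm.sameCycle_conj]
    simpa using hf.2 x hx y hy

lemma apply_mem (hf : CyclicOn f S) {x : X} (hx : x ∈ S) : f x ∈ S := by
  by_cases h : f x = x
  · rwa [h]
  · exact hf.1 _ fun h' => h (f.injective h')

lemma mul [Finite X] (hf : CyclicOn f S) (hg : CyclicOn g T) {x : X} (h : S ∩ T = {x}) :
    CyclicOn (f * g) (S ∪ T) := by
  have hxm : x ∈ S ∩ T := by rw [h]; rfl
  have hST : ∀ y, y ∈ S → y ∈ T → y = x := fun y h1 h2 => by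
    have : y ∈ S ∩ T := ⟨h1, h2⟩
    rwa [h] at this
  refine ⟨fun y hy => ?_, ?_⟩
  · by_contra hn
    rw [Set.mem_union, not_or] at hn
    have h1 : g y = y := by by_contra h'; exact hn.2 (hg.1 _ h')
    have h2 : f y = y := by by_contra h'; exact hn.1 (hf.1 _ h')
    exact hy (by rw [Equiv.Perm.mul_apply, h1, h2])
  have hS : ∀ j : ℕ, (f⁻¹ ^ j) x ∈ S ∧ (f * g).SameCycle x ((f⁻¹ ^ j) x) := by
    intro j
    induction j with
    | zero => exact ⟨hxm.1, Equiv.Perm.SameCycle.refl _ _⟩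
    | succ j ih =>
      rw [pow_succ', Equiv.Perm.mul_apply]
      set z := (f⁻¹ ^ j) x
      have hm := hf.inv.apply_mem ih.1
      refine ⟨hm, ?_⟩
      by_cases hz : f⁻¹ z = x
      · rw [hz]
      · have hgz : g (f⁻¹ z) = f⁻¹ z := by
          by_contra h'
          exact hz (hST _ hm (hg.1 _ h'))
        refine ih.2.trans (Equiv.Perm.SameCycle.symm ⟨1, ?_⟩)
        rw [zpow_one, Equiv.Perm.mul_apply, hgz, ← Equiv.Perm.mul_apply, mul_inv_cancel,
          Equiv.Perm.one_apply]
  have hT : ∀ j : ℕ, (g ^ j) x ∈ T ∧ (f * g).SameCycle x ((g ^ j) x) := by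
    intro j
    induction j with
    | zero => exact ⟨hxm.2, Equiv.Perm.SameCycle.refl _ _⟩
    | succ j ih =>
      rw [pow_succ', Equiv.Perm.mul_apply]
      set z := (g ^ j) x
      have hm := hg.apply_mem ih.1
      refine ⟨hm, ?_⟩
      by_cases hz : g z = x
      · rw [hz]
      · have hfz : f (g z) = g z := by
          by_contra h'
          exact hz (hST _ (hf.1 _ h') hm)
        refine ih.2.trans ⟨1, ?_⟩
        rw [zpow_one, Equiv.Perm.mul_apply, hfz]
  have key : ∀ y ∈ S ∪ T, (f * g).SameCycle x y := by
    rintro y (hy | hy)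
    · obtain ⟨j, rfl⟩ := (hf.inv.2 x hxm.1 y hy).exists_nat_pow_eq
      exact (hS j).2
    · obtain ⟨j, rfl⟩ := (hg.2 x hxm.2 y hy).exists_nat_pow_eq
      exact (hT j).2
  exact fun y hy z hz => (key y hy).symm.trans (key z hz)

lemma isPCycle {m n : ℕ} {p : Fin m → Fin n} {f : Equiv.Perm (Fin m)} {S : Set (Fin m)}
    (hf : CyclicOn f S) (hp : Set.InjOn p S) : IsPCycle p f := by
  refine ⟨hp.mono hf.1, ?_⟩
  by_cases h : ∃ x, f x ≠ x
  · obtain ⟨x, hx⟩ := h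
    exact Or.inr ⟨x, hx, fun y hy => hf.2 x (hf.1 x hx) y (hf.1 y hy)⟩
  · push Not at h
    exact Or.inl (Equiv.ext h)

end CyclicOn

/-- All cycles of `ρ` and a fixed point `x` of `ρ` can be joined into a single cycle by a
cycle through `x` and one prescribed point of every cycle of `ρ`. -/
lemma exists_join_cycles {X : Type*} [Fintype X] [DecidableEq X] (r : Equiv.Perm X → X)
    (x : X) (ρ : Equiv.Perm X) (hr : ∀ c ∈ ρ.cycleFactorsFinset, r c ∈ c.support)
    (hx : ρ x = x) :
    ∃ τ : Equiv.Perm X, CyclicOn (ρ * τ) (insert x {y | ρ y ≠ y}) ∧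
      CyclicOn τ (insert x (r '' (ρ.cycleFactorsFinset : Set (Equiv.Perm X)))) := by
  have step : ∀ c σ : Equiv.Perm X, c.Disjoint σ → c.IsCycle → r c ∈ c.support → c x = x →
      σ x = x → (∀ d ∈ σ.cycleFactorsFinset, r d ∈ d.support) → ∀ τ : Equiv.Perm X,
      CyclicOn (σ * τ) (insert x {y | σ y ≠ y}) →
      CyclicOn τ (insert x (r '' (σ.cycleFactorsFinset : Set (Equiv.Perm X)))) →
      ∃ τ : Equiv.Perm X, CyclicOn (c * σ * τ) (insert x {y | (c * σ) y ≠ y}) ∧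
        CyclicOn τ (insert x (r '' ((c * σ).cycleFactorsFinset : Set (Equiv.Perm X)))) := by
    intro c σ hd hc hrc hcx hσx hrσ τ h1 h2
    have hrc' : c (r c) ≠ r c := Equiv.Perm.mem_support.1 hrc
    have hne : r c ≠ x := fun h => hrc' (by rw [h, hcx])
    have hσr : σ (r c) = r c := (hd (r c)).resolve_left hrc'
    have hrσ' : ∀ d ∈ σ.cycleFactorsFinset, σ (r d) ≠ r d := fun d hdm =>
      Equiv.Perm.mem_support.1 (Equiv.Perm.mem_cycleFactorsFinset_support_le hdm (hrσ d hdm))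
    have hτr : τ (r c) = r c := by
      by_contra h
      rcases h2.1 _ h with h | ⟨d, hdm, hdr⟩
      · exact hne h
      · exact hrσ' d hdm (by rw [hdr, hσr])
    have hcs : CyclicOn (c * Equiv.swap x (r c)) ({y | c y ≠ y} ∪ {x, r c}) := by
      refine (CyclicOn.of_isCycle hc).mul (CyclicOn.swap _ _) (x := r c) ?_
      ext y
      simp only [Set.mem_inter_iff, Set.mem_ofPred_eq, Set.mem_insert_iff, Set.mem_singleton_iff]
      grind
    refine ⟨τ * Equiv.swap x (r c), ?_, ?_⟩
    · have hcomm : c * σ * (τ * Equiv.swap x (r c)) = σ * τ * (c * Equiv.swap x (r c)) := by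
        have hcτ : Commute c (σ * τ) := by
          refine Equiv.Perm.Disjoint.commute fun y => ?_
          by_cases hy : c y = y
          · exact Or.inl hy
          · refine Or.inr ?_
            by_contra h
            rcases h1.1 _ h with h | h
            · exact hy (h ▸ hcx)
            · exact h ((hd y).resolve_left hy)
        rw [← mul_assoc, mul_assoc c, hcτ.eq, mul_assoc]
      rw [hcomm]
      convert h1.mul hcs (x := x) ?_ using 1
      · ext y
        have hmul : (c * σ) y = y ↔ c y = y ∧ σ y = y := hd.mul_apply_eq_iff
        simp only [Set.mem_union, Set.mem_ofPred_eq, Set.mem_insert_iff, Set.mem_singleton_iff,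
          ne_eq, hmul]
        grind
      · ext y
        have := hd y
        simp only [Set.mem_inter_iff, Set.mem_union, Set.mem_ofPred_eq, Set.mem_insert_iff,
          Set.mem_singleton_iff]
        grind
    · convert h2.mul (CyclicOn.swap x (r c)) (x := x) ?_ using 1
      · rw [hd.cycleFactorsFinset_mul_eq_union,
          Equiv.Perm.cycleFactorsFinset_eq_singleton_self_iff.2 hc]
        ext y
        simp only [Finset.coe_union, Finset.coe_singleton, Set.image_union, Set.image_singleton,
          Set.mem_union, Set.mem_insert_iff, Set.mem_singleton_iff]
        tauto
      · ext y
        simp only [Set.mem_inter_iff, Set.mem_insert_iff, Set.mem_singleton_iff, Set.mem_image]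
        constructor
        · rintro ⟨h | ⟨d, hdm, rfl⟩, h' | h'⟩
          · exact h
          · exact h
          · exact h'
          · exact absurd (h' ▸ hσr) (hrσ' d hdm)
        · tauto
  induction ρ using Equiv.Perm.cycle_induction_on with
  | base_one =>
    refine ⟨1, ?_, ?_⟩
    · simpa using CyclicOn.one x
    · simpa [Equiv.Perm.cycleFactorsFinset_eq_empty_iff.2 rfl] using CyclicOn.one x
  | base_cycles c hc =>
    have := step c 1 (Equiv.Perm.disjoint_one_right c) hc (hr c (by
      rw [Equiv.Perm.cycleFactorsFinset_eq_singleton_self_iff.2 hc]; simp)) hx rfl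
      (by simp [Equiv.Perm.cycleFactorsFinset_eq_empty_iff.2 rfl]) 1
      (by simpa using CyclicOn.one x)
      (by simpa [Equiv.Perm.cycleFactorsFinset_eq_empty_iff.2 rfl] using CyclicOn.one x)
    simpa only [mul_one] using this
  | induction_disjoint c σ hd hc _ ih =>
    have hx' := hd.mul_apply_eq_iff.1 hx
    rw [hd.cycleFactorsFinset_mul_eq_union,
      Equiv.Perm.cycleFactorsFinset_eq_singleton_self_iff.2 hc] at hr
    obtain ⟨τ, h1, h2⟩ := ih (fun d hdm => hr d (Finset.mem_union_right _ hdm)) hx'.2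
    exact step c σ hd hc (hr c (by simp)) hx'.1 hx'.2
      (fun d hdm => hr d (Finset.mem_union_right _ hdm)) τ h1 h2

/-- Two cycles `D` and `E` meeting only in `b`, together with further pairwise disjoint cycles
making up `ρ₁` and `ρ₂`, are a product of three cycles, the first of which passes through one
prescribed point of each of the further cycles. -/
lemma exists_three_cycles {X : Type*} [Fintype X] [DecidableEq X] (r : Equiv.Perm X → X)
    {D E ρ₁ ρ₂ : Equiv.Perm X} {S₁ S₂ : Set X} {b : X}
    (hD : CyclicOn D S₁) (hE : CyclicOn E S₂) (hb : S₁ ∩ S₂ = {b})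
    (h11 : ∀ y ∈ S₁, ρ₁ y = y) (h21 : ∀ y ∈ S₂, ρ₁ y = y) (h22 : ∀ y ∈ S₂, ρ₂ y = y)
    (hρ : ρ₁.Disjoint ρ₂)
    (hr₁ : ∀ c ∈ ρ₁.cycleFactorsFinset, r c ∈ c.support)
    (hr₂ : ∀ c ∈ ρ₂.cycleFactorsFinset, r c ∈ c.support) :
    ∃ σ₁ σ₂ σ₃ : Equiv.Perm X, D * ρ₁ * (E * ρ₂) = σ₃ * σ₂ * σ₁ ∧
      CyclicOn σ₁ (insert (E⁻¹ b) (r '' ((ρ₁ * ρ₂).cycleFactorsFinset : Set (Equiv.Perm X)))) ∧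
      CyclicOn σ₂ (S₂ ∪ {y | ρ₂ y ≠ y}) ∧ CyclicOn σ₃ (S₁ ∪ {y | ρ₁ y ≠ y}) := by
  have hbm : b ∈ S₁ ∩ S₂ := by rw [hb]; rfl
  set w := E⁻¹ b with hw
  have hwm : w ∈ S₂ := hE.inv.apply_mem hbm.2
  obtain ⟨τ₁, hA₁, hT₁⟩ := exists_join_cycles r b ρ₁ hr₁ (h11 b hbm.1)
  obtain ⟨τ₂, hA₂, hT₂⟩ := exists_join_cycles r w ρ₂ hr₂ (h22 w hwm)
  have h3 : CyclicOn (D * (ρ₁ * τ₁)) (S₁ ∪ {y | ρ₁ y ≠ y}) := by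
    convert hD.mul hA₁ (x := b) ?_ using 1
    · ext y
      simp only [Set.mem_union, Set.mem_ofPred_eq, Set.mem_insert_iff]
      grind
    · ext y
      simp only [Set.mem_inter_iff, Set.mem_ofPred_eq, Set.mem_insert_iff, Set.mem_singleton_iff]
      grind
  have h2 : CyclicOn (E * (ρ₂ * τ₂)) (S₂ ∪ {y | ρ₂ y ≠ y}) := by
    convert hE.mul hA₂ (x := w) ?_ using 1
    · ext y
      simp only [Set.mem_union, Set.mem_ofPred_eq, Set.mem_insert_iff]
      grind
    · ext y
      simp only [Set.mem_inter_iff, Set.mem_ofPred_eq, Set.mem_insert_iff, Set.mem_singleton_iff]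
      grind
  set σ₂ := E * (ρ₂ * τ₂) with hσ₂
  have hq : σ₂⁻¹ b = τ₂⁻¹ w := by
    rw [hσ₂, mul_inv_rev, mul_inv_rev, Equiv.Perm.mul_apply, Equiv.Perm.mul_apply, ← hw]
    congr 1
    rw [Equiv.Perm.inv_eq_iff_eq, h22 w hwm]
  have hqm : σ₂⁻¹ b ∈ insert w (r '' (ρ₂.cycleFactorsFinset : Set (Equiv.Perm X))) := by
    rw [hq]
    exact hT₂.inv.apply_mem (Set.mem_insert _ _)
  have hR₁ : ∀ c ∈ ρ₁.cycleFactorsFinset, ρ₁ (r c) ≠ r c := fun c hc =>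
    Equiv.Perm.mem_support.1 (Equiv.Perm.mem_cycleFactorsFinset_support_le hc (hr₁ c hc))
  have hR₂ : ∀ c ∈ ρ₂.cycleFactorsFinset, ρ₂ (r c) ≠ r c := fun c hc =>
    Equiv.Perm.mem_support.1 (Equiv.Perm.mem_cycleFactorsFinset_support_le hc (hr₂ c hc))
  have hfix : ∀ y, ρ₁ y ≠ y → σ₂⁻¹ y = y := by
    intro y hy
    by_contra h
    rcases h2.inv.1 y h with h | h
    · exact hy (h21 y h)
    · exact h ((hρ y).resolve_left hy)
  have himg : ⇑σ₂⁻¹ '' (insert b (r '' (ρ₁.cycleFactorsFinset : Set (Equiv.Perm X)))) =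
      insert (σ₂⁻¹ b) (r '' (ρ₁.cycleFactorsFinset : Set (Equiv.Perm X))) := by
    rw [Set.image_insert_eq, Set.image_image]
    congr 1
    exact Set.image_congr fun c hc => hfix _ (hR₁ c hc)
  have hc₁ := hT₁.inv.conj σ₂⁻¹
  rw [himg] at hc₁
  refine ⟨σ₂⁻¹ * τ₁⁻¹ * σ₂⁻¹⁻¹ * τ₂⁻¹, σ₂, D * (ρ₁ * τ₁), ?_, ?_, h2, h3⟩
  · rw [hσ₂]
    group
  · convert hc₁.mul hT₂.inv (x := σ₂⁻¹ b) ?_ using 1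
    · rw [hρ.cycleFactorsFinset_mul_eq_union, Finset.coe_union, Set.image_union]
      ext y
      simp only [Set.mem_union, Set.mem_insert_iff] at hqm ⊢
      grind
    · ext y
      simp only [Set.mem_inter_iff, Set.mem_singleton_iff]
      constructor
      · rintro ⟨h | ⟨c, hc, rfl⟩, h' | ⟨d, hd, h'⟩⟩
        · exact h
        · exact h
        · exact absurd (h21 _ (h' ▸ hwm)) (hR₁ c hc)
        · exact absurd ((hρ (r c)).resolve_left (hR₁ c hc)) (h' ▸ hR₂ d hd)
      · rintro rfl
        exact ⟨Set.mem_insert _ _, hqm⟩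

/-- A system of representatives for the cycles of `θ` in pairwise distinct fibers of `p`, all
different from the fiber of a given fixed point. -/
lemma exists_cycle_representatives {X V : Type*} [Fintype X] [DecidableEq X] [DecidableEq V]
    {p : X → V} (hp : ∀ i, (Finset.univ.filter fun x => p x = i).card ≤ 2)
    (θ : Equiv.Perm X) {w : X} (hw : θ w = w) :
    ∃ r : Equiv.Perm X → X, (∀ c ∈ θ.cycleFactorsFinset, r c ∈ c.support) ∧
      (∀ c ∈ θ.cycleFactorsFinset, ∀ d ∈ θ.cycleFactorsFinset, p (r c) = p (r d) → c = d) ∧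
      ∀ c ∈ θ.cycleFactorsFinset, p (r c) ≠ p w := by
  let t : θ.cycleFactorsFinset → Finset V := fun c =>
    (c.1.support.filter fun x => p x ≠ p w).image p
  have hall : ∀ s : Finset θ.cycleFactorsFinset, s.card ≤ (s.biUnion t).card := by
    intro s
    set U := s.biUnion fun c => c.1.support with hU
    have hUcard : 2 * s.card ≤ U.card := by
      rw [hU, Finset.card_biUnion, mul_comm, ← smul_eq_mul]
      · refine Finset.card_nsmul_le_sum _ _ _ fun c _ => ?_
        exact (Equiv.Perm.mem_cycleFactorsFinset_iff.1 c.2).1.two_le_card_support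
      · intro c _ d _ hcd
        exact (Equiv.Perm.cycleFactorsFinset_pairwise_disjoint θ c.2 d.2
          (fun h => hcd (Subtype.ext h))).disjoint_support
    have hwU : w ∉ U := by
      simp only [hU, Finset.mem_biUnion, not_exists, not_and]
      intro c _ hc
      exact Equiv.Perm.mem_support.1 (Equiv.Perm.mem_cycleFactorsFinset_support_le c.2 hc) hw
    have hsplit := Finset.card_filter_add_card_filter_not (s := U) (fun x => p x ≠ p w)
    have hone : (U.filter fun x => ¬ p x ≠ p w).card + 1 ≤ 2 := by
      rw [← Finset.card_insert_of_notMem (a := w)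
        (fun h => hwU (Finset.mem_filter.1 h).1)]
      refine le_trans (Finset.card_le_card fun x hx => ?_) (hp (p w))
      simp only [Finset.mem_insert, Finset.mem_filter, not_not, Finset.mem_univ,
        true_and] at hx ⊢
      rcases hx with rfl | hx
      · rfl
      · exact hx.2
    have himg : s.biUnion t = (U.filter fun x => p x ≠ p w).image p := by
      ext i
      simp only [t, hU, Finset.mem_biUnion, Finset.mem_image, Finset.mem_filter]
      constructor
      · rintro ⟨c, hc, x, ⟨hx, hxw⟩, rfl⟩
        exact ⟨x, ⟨⟨c, hc, hx⟩, hxw⟩, rfl⟩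
      · rintro ⟨x, ⟨⟨c, hc, hx⟩, hxw⟩, rfl⟩
        exact ⟨c, hc, x, ⟨hx, hxw⟩, rfl⟩
    have hle : (U.filter fun x => p x ≠ p w).card ≤ 2 * (s.biUnion t).card := by
      rw [himg]
      refine Finset.card_le_mul_card_image _ 2 fun i _ => le_trans (Finset.card_le_card ?_) (hp i)
      exact Finset.filter_subset_filter _ (Finset.subset_univ _)
    omega
  obtain ⟨f, hf, hft⟩ := (Finset.all_card_le_biUnion_card_iff_exists_injective t).1 hall
  have hex : ∀ c : Equiv.Perm X, ∃ x : X, ∀ hc : c ∈ θ.cycleFactorsFinset,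
      x ∈ c.support ∧ p x ≠ p w ∧ p x = f ⟨c, hc⟩ := by
    intro c
    by_cases hc : c ∈ θ.cycleFactorsFinset
    · obtain ⟨x, hx, hxf⟩ := Finset.mem_image.1 (hft ⟨c, hc⟩)
      rw [Finset.mem_filter] at hx
      exact ⟨x, fun _ => ⟨hx.1, hx.2, hxf⟩⟩
    · exact ⟨w, fun h => absurd h hc⟩
  choose r hr using hex
  refine ⟨r, fun c hc => (hr c hc).1, fun c hc d hd h => ?_, fun c hc => (hr c hc).2.1⟩
  rw [(hr c hc).2.2, (hr d hd).2.2] at h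
  exact congrArg Subtype.val (hf h)

lemma two_le_fiberCard {m n : ℕ} {p : Fin m → Fin n} {x y : Fin m} (hxy : x ≠ y)
    (h : p x = p y) : 2 ≤ fiberCard p (p x) := by
  rw [← Finset.card_pair hxy]
  refine Finset.card_le_card fun z hz => ?_
  simp only [Finset.mem_insert, Finset.mem_singleton, Finset.mem_filter, Finset.mem_univ,
    true_and] at hz ⊢
  rcases hz with rfl | rfl
  · rfl
  · exact h.symm

lemma eq_or_eq_of_fiberCard_le_two {m n : ℕ} {p : Fin m → Fin n} {x y z : Fin m}
    (hp : fiberCard p (p x) ≤ 2) (hxy : x ≠ y) (hy : p y = p x) (hz : p z = p x) :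
    z = x ∨ z = y := by
  by_contra h
  push Not at h
  have h3 : ({z, x, y} : Finset (Fin m)).card = 3 := by
    rw [Finset.card_eq_three]
    exact ⟨z, x, y, h.1, h.2, hxy, rfl⟩
  have : ({z, x, y} : Finset (Fin m)).card ≤ fiberCard p (p x) := by
    refine Finset.card_le_card fun t ht => ?_
    simp only [Finset.mem_insert, Finset.mem_singleton, Finset.mem_filter, Finset.mem_univ,
      true_and] at ht ⊢
    rcases ht with rfl | rfl | rfl
    · exact hz
    · rfl
    · exact hy
  omega

lemma exists_apply_eq_of_fiberCard_pos {m n : ℕ} {p : Fin m → Fin n} {i : Fin n}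
    (h : 0 < fiberCard p i) : ∃ x, p x = i := by
  obtain ⟨x, hx⟩ := Finset.card_pos.1 h
  exact ⟨x, (Finset.mem_filter.1 hx).2⟩

/-- Two partitions of the same shape with fibers of size at most 2 differ by a permutation that
preserves a set on which, as on its complement, the first partition is injective. -/
lemma exists_perm_preserving_transversal {m n : ℕ} {p p' : Fin m → Fin n}
    (hshape : ∀ i, fiberCard p i = fiberCard p' i) (hfib : ∀ i, fiberCard p i ≤ 2) :
    ∃ (π : Equiv.Perm (Fin m)) (A : Set (Fin m)), (∀ x, p (π x) = p' x) ∧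
      (∀ x, π x ∈ A ↔ x ∈ A) ∧ Set.InjOn p A ∧ Set.InjOn p Aᶜ := by
  classical
  let t : Fin n → Finset (Fin n) := fun i =>
    (Finset.univ.filter fun x => p x = i).image p' ∪ if fiberCard p i < 2 then {i} else ∅
  have hall : ∀ s : Finset (Fin n), s.card ≤ (s.biUnion t).card := by
    intro s
    set N := s.biUnion t with hN
    have hsum : ∀ (q : Fin m → Fin n) (u : Finset (Fin n)),
        (Finset.univ.filter fun x => q x ∈ u).card = ∑ i ∈ u, fiberCard q i := by
      intro q u
      rw [Finset.card_eq_sum_card_fiberwise (f := q) (t := u) (fun x hx => by simpa using hx)]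
      refine Finset.sum_congr rfl fun i hi => ?_
      unfold fiberCard
      congr 1
      ext x
      simp only [Finset.mem_filter, Finset.mem_univ, true_and]
      grind
    have h1 : ∑ i ∈ s, fiberCard p i ≤ ∑ i ∈ N, fiberCard p i := by
      rw [← hsum, Finset.sum_congr rfl fun i _ => hshape i, ← hsum]
      refine Finset.card_le_card fun x hx => ?_
      simp only [Finset.mem_filter, Finset.mem_univ, true_and] at hx ⊢
      refine Finset.mem_biUnion.2 ⟨p x, hx, Finset.mem_union_left _ ?_⟩
      exact Finset.mem_image.2 ⟨x, by simp, rfl⟩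
    have h2 : ∑ i ∈ s, (2 - fiberCard p i) ≤ ∑ i ∈ N, (2 - fiberCard p i) := by
      refine Finset.sum_le_sum_of_ne_zero fun i hi hne => ?_
      refine Finset.mem_biUnion.2 ⟨i, hi, Finset.mem_union_right _ ?_⟩
      rw [if_pos (by omega)]
      exact Finset.mem_singleton_self i
    have h3 : ∀ u : Finset (Fin n),
        ∑ i ∈ u, fiberCard p i + ∑ i ∈ u, (2 - fiberCard p i) = u.card * 2 := by
      intro u
      rw [← Finset.sum_add_distrib, ← smul_eq_mul, ← Finset.sum_const]
      exact Finset.sum_congr rfl fun i _ => Nat.add_sub_cancel' (hfib i)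
    have := h3 s
    have := h3 N
    omega
  obtain ⟨f, hf, hft⟩ := (Finset.all_card_le_biUnion_card_iff_exists_injective t).1 hall
  have hsurj : Function.Surjective f := Finite.surjective_of_injective hf
  have hex : ∀ i, ∃ o : Option (Fin m), (∀ x, o = some x → p x = i ∧ p' x = f i) ∧
      (o = none → fiberCard p i < 2 ∧ f i = i) := by
    intro i
    rcases Finset.mem_union.1 (hft i) with h | h
    · obtain ⟨x, hx, hxf⟩ := Finset.mem_image.1 h
      refine ⟨some x, fun y hy => ?_, by simp⟩
      cases hy
      exact ⟨(Finset.mem_filter.1 hx).2, hxf⟩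
    · refine ⟨none, by simp, fun _ => ?_⟩
      split_ifs at h with hlt
      · exact ⟨hlt, Finset.mem_singleton.1 h⟩
      · simp at h
  choose g hgs hgn using hex
  set A : Set (Fin m) := {x | g (p x) = some x} with hA
  have hmem : ∀ i z, g i = some z → z ∈ A := fun i z h => by
    rw [hA, Set.mem_ofPred_eq, (hgs i z h).1, h]
  have hpA : Set.InjOn p A := by
    intro x hx y hy hxy
    rw [hA, Set.mem_ofPred_eq] at hx hy
    rw [hxy, hy] at hx
    exact (Option.some.inj hx).symm
  have hpAc : Set.InjOn p Aᶜ := by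
    intro x hx y hy hxy
    by_contra hne
    rcases ho : g (p x) with _ | z
    · have := two_le_fiberCard hne hxy
      have := (hgn _ ho).1
      omega
    · rcases eq_or_eq_of_fiberCard_le_two (hfib _) hne hxy.symm (hgs _ _ ho).1 with h | h
      · exact hx (h ▸ hmem _ _ ho)
      · exact hy (h ▸ hmem _ _ ho)
  have hp'A : Set.InjOn p' A := by
    intro x hx y hy hxy
    have h1 := hgs _ _ hx
    have h2 := hgs _ _ hy
    exact hpA hx hy (hf (by rw [← h1.2, ← h2.2, hxy]))
  have hp'Ac : Set.InjOn p' Aᶜ := by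
    intro x hx y hy hxy
    by_contra hne
    have h2 := two_le_fiberCard hne hxy
    obtain ⟨i, hi⟩ := hsurj (p' x)
    rcases ho : g i with _ | z
    · have := (hgn _ ho).1
      rw [(hgn _ ho).2] at hi
      rw [hi, hshape] at this
      omega
    · have hz := (hgs _ _ ho).2
      rw [hi] at hz
      rcases eq_or_eq_of_fiberCard_le_two (hshape _ ▸ hfib _) hne hxy.symm hz with h | h
      · exact hx (h ▸ hmem _ _ ho)
      · exact hy (h ▸ hmem _ _ ho)
  have hnext : ∀ x, ∃ y, (y ∈ A ↔ x ∈ A) ∧ p y = p' x := by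
    intro x
    by_cases hx : x ∈ A
    · have h1 := (hgs _ _ hx).2
      rcases ho : g (p' x) with _ | y
      · have h2 := (hgn _ ho).2
        have h3 : p' x = p x := hf (h2.trans h1)
        rw [h3, hx] at ho
        simp at ho
      · exact ⟨y, by simp [hx, hmem _ _ ho], (hgs _ _ ho).1⟩
    · by_contra hno
      push Not at hno
      have hin : ∀ y, p y = p' x → y ∈ A := fun y hy => by
        by_contra hyA
        exact hno y (by simp [hx, hyA]) hy
      have hpos : 0 < fiberCard p (p' x) := by
        rw [hshape]
        exact Finset.card_pos.2 ⟨x, by simp⟩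
      obtain ⟨y, hy⟩ := exists_apply_eq_of_fiberCard_pos hpos
      have hyA : g (p y) = some y := hin y hy
      obtain ⟨i, hi⟩ := hsurj (p' x)
      rcases ho : g i with _ | z
      · have h2 := (hgn _ ho).2
        rw [← h2, hi, ← hy, hyA] at ho
        simp at ho
      · have hz := (hgs _ _ ho).2
        rw [hi] at hz
        have hzx : z ≠ x := fun h => hx (h ▸ hmem _ _ ho)
        have hone : fiberCard p (p' x) ≤ 1 := by
          refine Finset.card_le_one.2 fun a ha b hb => ?_
          have ha' := (Finset.mem_filter.1 ha).2
          have hb' := (Finset.mem_filter.1 hb).2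
          exact hpA (hin a ha') (hin b hb') (ha'.trans hb'.symm)
        have := two_le_fiberCard hzx hz
        rw [hz, ← hshape] at this
        omega
  choose π hπA hπ using hnext
  have hinj : Function.Injective π := by
    intro x y hxy
    have h : p' x = p' y := by rw [← hπ, ← hπ, hxy]
    have hiff : x ∈ A ↔ y ∈ A := by rw [← hπA x, ← hπA y, hxy]
    by_cases hx : x ∈ A
    · exact hp'A hx (hiff.1 hx) h
    · exact hp'Ac hx (fun hy => hx (hiff.2 hy)) h
  exact ⟨Equiv.ofBijective π (Finite.injective_iff_bijective.1 hinj), A, hπ, hπA, hpA, hpAc⟩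

lemma Equiv.Perm.exists_eq_cycleOf_mul {X : Type*} [Fintype X] [DecidableEq X]
    (f : Equiv.Perm X) (a : X) :
    ∃ θ : Equiv.Perm X, f = f.cycleOf a * θ ∧ (∀ y, f.SameCycle a y → θ y = y) ∧
      ∀ y, ¬ f.SameCycle a y → θ y = f y := by
  refine ⟨(f.cycleOf a)⁻¹ * f, by group, fun y hy => ?_, fun y hy => ?_⟩
  · rw [Equiv.Perm.mul_apply, Equiv.Perm.inv_eq_iff_eq, hy.cycleOf_apply]
  · rw [Equiv.Perm.mul_apply, Equiv.Perm.inv_eq_iff_eq,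
      Equiv.Perm.cycleOf_apply_of_not_sameCycle]
    rwa [Equiv.Perm.sameCycle_apply_right]

lemma Equiv.Perm.exists_eq_mul_of_preserves {X : Type*} {θ : Equiv.Perm X} {A : Set X}
    (hA : ∀ x, θ x ∈ A ↔ x ∈ A) :
    ∃ ρ₁ ρ₂ : Equiv.Perm X, θ = ρ₁ * ρ₂ ∧ ρ₁.Disjoint ρ₂ ∧
      (∀ y, ρ₁ y ≠ y ↔ y ∈ A ∧ θ y ≠ y) ∧ ∀ y, ρ₂ y ≠ y ↔ y ∉ A ∧ θ y ≠ y := by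
  classical
  have key : ∀ B : Set X, (∀ x, θ x ∈ B ↔ x ∈ B) → ∃ ρ : Equiv.Perm X,
      (∀ y ∈ B, ρ y = θ y) ∧ ∀ y ∉ B, ρ y = y := by
    intro B hB
    refine ⟨Equiv.Perm.ofSubtype (θ.subtypePerm (p := fun x => x ∈ B) hB), fun y hy => ?_,
      fun y hy => ?_⟩
    · rw [Equiv.Perm.ofSubtype_apply_of_mem _ hy]
      rfl
    · exact Equiv.Perm.ofSubtype_apply_of_not_mem _ hy
  obtain ⟨ρ₁, h1, h1'⟩ := key A hA
  obtain ⟨ρ₂, h2, h2'⟩ := key Aᶜ fun x => not_congr (hA x)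
  refine ⟨ρ₁, ρ₂, Equiv.ext fun y => ?_, fun y => ?_, fun y => ?_, fun y => ?_⟩ <;>
  by_cases hy : y ∈ A
  · rw [Equiv.Perm.mul_apply, h2' y (not_not.2 hy), h1 y hy]
  · rw [Equiv.Perm.mul_apply, h2 y hy, h1' _ (mt (hA y).1 hy)]
  · exact Or.inr (h2' y (not_not.2 hy))
  · exact Or.inl (h1' y hy)
  · simp [h1 y hy, hy]
  · simp [h1' y hy, hy]
  · simp [h2' y (not_not.2 hy), hy]
  · simp [h2 y hy, hy]

lemma Equiv.Perm.SameCycle.mem_iff_of_preserves {X : Type*} [Finite X] {f : Equiv.Perm X}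
    {A : Set X} (hA : ∀ x, f x ∈ A ↔ x ∈ A) {x y : X} (h : f.SameCycle x y) :
    x ∈ A ↔ y ∈ A := by
  obtain ⟨j, rfl⟩ := h.exists_nat_pow_eq
  clear h
  induction j with
  | zero => rfl
  | succ j ih => rw [pow_succ', Equiv.Perm.mul_apply, hA, ih]

/-- Three cycles suffice if some slot `a` is the only point of its fiber moved by `π`. -/
lemma exists_pCycles_of_lonely {m n : ℕ} {p : Fin m → Fin n} {π : Equiv.Perm (Fin m)}
    {A : Set (Fin m)} (hfib : ∀ i, fiberCard p i ≤ 2) (hA : ∀ x, π x ∈ A ↔ x ∈ A)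
    (hpA : Set.InjOn p A) (hpAc : Set.InjOn p Aᶜ) {a : Fin m} (ha : a ∈ A)
    (hlone : ∀ y, p y = p a → y ≠ a → π y = y) :
    ∃ σ₁ σ₂ σ₃ : Equiv.Perm (Fin m), IsPCycle p σ₁ ∧ IsPCycle p σ₂ ∧ IsPCycle p σ₃ ∧
      ∀ x, p (π x) = p ((σ₃ * σ₂ * σ₁) x) := by
  obtain ⟨θ, hπ, hθ1, hθ2⟩ := π.exists_eq_cycleOf_mul a
  have hθa : θ a = a := hθ1 a (Equiv.Perm.SameCycle.refl _ _)
  have hθA : ∀ x, θ x ∈ A ↔ x ∈ A := fun x => by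
    by_cases h : π.SameCycle a x
    · rw [hθ1 x h]
    · rw [hθ2 x h, hA]
  have hθπ : ∀ x, θ x ≠ x → π x ≠ x := fun x hx => by
    by_cases h : π.SameCycle a x
    · exact absurd (hθ1 x h) hx
    · rwa [← hθ2 x h]
  obtain ⟨ρ₁, ρ₂, hρ, hd, h1, h2⟩ := Equiv.Perm.exists_eq_mul_of_preserves hθA
  obtain ⟨r, hr, hrinj, hra⟩ := exists_cycle_representatives hfib θ hθa
  have hfac : θ.cycleFactorsFinset = ρ₁.cycleFactorsFinset ∪ ρ₂.cycleFactorsFinset := by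
    rw [hρ, hd.cycleFactorsFinset_mul_eq_union]
  have hfixes : ∀ (ρ : Equiv.Perm (Fin m)) (P : Fin m → Prop),
      (∀ y, ρ y ≠ y ↔ P y ∧ θ y ≠ y) → ∀ y, θ y = y → ρ y = y := fun ρ P h y hy => by
    by_contra hne
    exact ((h y).1 hne).2 hy
  obtain ⟨σ₁, σ₂, σ₃, hprod, hc1, hc2, hc3⟩ :=
    exists_three_cycles r (CyclicOn.cycleOf π a) (CyclicOn.one a) (b := a) (ρ₁ := ρ₁) (ρ₂ := ρ₂)
      (by
        ext y
        simp only [Set.mem_inter_iff, Set.mem_ofPred_eq, Set.mem_singleton_iff,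
          and_iff_right_iff_imp]
        rintro rfl
        exact Equiv.Perm.SameCycle.refl _ _)
      (fun y hy => hfixes _ _ h1 y (hθ1 y hy))
      (fun y hy => hfixes _ _ h1 y (by rw [Set.mem_singleton_iff.1 hy, hθa]))
      (fun y hy => hfixes _ _ h2 y (by rw [Set.mem_singleton_iff.1 hy, hθa]))
      hd (fun c hc => hr c (hfac ▸ Finset.mem_union_left _ hc))
      (fun c hc => hr c (hfac ▸ Finset.mem_union_right _ hc))
  refine ⟨σ₁, σ₂, σ₃, hc1.isPCycle ?_, hc2.isPCycle ?_, hc3.isPCycle ?_, fun x => ?_⟩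
  · rw [inv_one, Equiv.Perm.one_apply, ← hρ]
    rintro _ (rfl | ⟨c, hc, rfl⟩) _ (rfl | ⟨d, hd, rfl⟩) h
    · rfl
    · exact absurd h.symm (hra d hd)
    · exact absurd h (hra c hc)
    · rw [hrinj c hc d hd h]
  · rintro x (hx | hx) y (hy | hy) h
    · rw [Set.mem_singleton_iff.1 hx, Set.mem_singleton_iff.1 hy]
    · rw [Set.mem_singleton_iff] at hx
      subst hx
      by_contra hne
      exact hθπ y ((h2 y).1 hy).2 (hlone y h.symm (Ne.symm hne))
    · rw [Set.mem_singleton_iff] at hy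
      subst hy
      by_contra hne
      exact hθπ x ((h2 x).1 hx).2 (hlone x h hne)
    · exact hpAc ((h2 x).1 hx).1 ((h2 y).1 hy).1 h
  · refine hpA.mono ?_
    rintro y (hy | hy)
    · exact (hy.mem_iff_of_preserves hA).1 ha
    · exact ((h1 y).1 hy).1
  · rw [← hprod, one_mul, mul_assoc, ← hρ, ← hπ]

/-- Three cycles suffice if some slot `a` in `A` has a partner `b` in its fiber moved by `π`. -/
lemma exists_pCycles_of_partner_moved {m n : ℕ} {p : Fin m → Fin n} {π : Equiv.Perm (Fin m)}
    {A : Set (Fin m)} (hfib : ∀ i, fiberCard p i ≤ 2) (hA : ∀ x, π x ∈ A ↔ x ∈ A)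
    (hpA : Set.InjOn p A) (hpAc : Set.InjOn p Aᶜ) {a b : Fin m} (ha : a ∈ A) (hb : b ∉ A)
    (hab : p a = p b) (hπb : π b ≠ b) :
    ∃ σ₁ σ₂ σ₃ : Equiv.Perm (Fin m), IsPCycle p σ₁ ∧ IsPCycle p σ₂ ∧ IsPCycle p σ₃ ∧
      ∀ x, p (π x) = p ((σ₃ * σ₂ * σ₁) x) := by
  have hne : a ≠ b := fun h => hb (h ▸ ha)
  have hA1 : ∀ y, π.SameCycle a y → y ∈ A := fun y hy => (hy.mem_iff_of_preserves hA).1 ha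
  obtain ⟨θ₁, hπ, hθ1, hθ2⟩ := π.exists_eq_cycleOf_mul a
  have hθ₁A : ∀ x, θ₁ x ∈ A ↔ x ∈ A := fun x => by
    by_cases h : π.SameCycle a x
    · rw [hθ1 x h]
    · rw [hθ2 x h, hA]
  have hA2 : ∀ y, θ₁.SameCycle b y → y ∉ A := fun y hy =>
    mt (hy.mem_iff_of_preserves hθ₁A).2 hb
  have hθ₁b : θ₁ b ≠ b := by rwa [hθ2 b fun h => hb (hA1 b h)]
  obtain ⟨θ, hθ, hθ3, hθ4⟩ := θ₁.exists_eq_cycleOf_mul b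
  have hθA : ∀ x, θ x ∈ A ↔ x ∈ A := fun x => by
    by_cases h : θ₁.SameCycle b x
    · rw [hθ3 x h]
    · rw [hθ4 x h, hθ₁A]
  have hθ5 : ∀ y, π.SameCycle a y → θ y = y := fun y hy => by
    rw [hθ4 y fun h => hA2 y h (hA1 y hy), hθ1 y hy]
  have hθa : θ a = a := hθ5 a (Equiv.Perm.SameCycle.refl _ _)
  have hθb : θ b = b := hθ3 b (Equiv.Perm.SameCycle.refl _ _)
  set D := π.cycleOf a with hD
  set E := θ₁.cycleOf b with hE
  have hEc : CyclicOn E {y | θ₁.SameCycle b y} := CyclicOn.cycleOf θ₁ b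
  have hEb : E b ≠ b := by
    rwa [hE, Equiv.Perm.cycleOf_apply_self]
  set w := E⁻¹ b with hw
  have hwm : θ₁.SameCycle b w := hEc.inv.apply_mem (Equiv.Perm.SameCycle.refl _ _)
  have hwA : w ∉ A := hA2 w hwm
  have hwb : w ≠ b := fun h => hEb ((Equiv.Perm.inv_eq_iff_eq.1 h).symm)
  have hθw : θ w = w := hθ3 w hwm
  have hEa : E⁻¹ a = a := by
    by_contra h
    exact hA2 a (hEc.inv.1 a h) ha
  have hpw : p w ≠ p a := fun h => hwb (hpAc hwA hb (h.trans hab))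
  have hfiber : ∀ y, p y = p a → y = a ∨ y = b := fun y hy =>
    eq_or_eq_of_fiberCard_le_two (hfib _) hne hab.symm hy
  set s := Equiv.swap a b with hs
  have hps : ∀ x, p (s x) = p x := by
    intro x
    by_cases hxa : x = a
    · rw [hxa, hs, Equiv.swap_apply_left, hab]
    by_cases hxb : x = b
    · rw [hxb, hs, Equiv.swap_apply_right, hab]
    rw [hs, Equiv.swap_apply_of_ne_of_ne hxa hxb]
  obtain ⟨ρ₁, ρ₂, hρ, hd, h1, h2⟩ := Equiv.Perm.exists_eq_mul_of_preserves hθA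
  obtain ⟨r, hr, hrinj, hrw⟩ := exists_cycle_representatives hfib θ hθw
  have hfac : θ.cycleFactorsFinset = ρ₁.cycleFactorsFinset ∪ ρ₂.cycleFactorsFinset := by
    rw [hρ, hd.cycleFactorsFinset_mul_eq_union]
  have hrθ : ∀ c ∈ θ.cycleFactorsFinset, θ (r c) ≠ r c := fun c hc =>
    Equiv.Perm.mem_support.1 (Equiv.Perm.mem_cycleFactorsFinset_support_le hc (hr c hc))
  have hra : ∀ c ∈ θ.cycleFactorsFinset, p (r c) ≠ p a := fun c hc h => by
    rcases hfiber _ h with h | h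
    · exact hrθ c hc (by rw [h, hθa])
    · exact hrθ c hc (by rw [h, hθb])
  have hfixes : ∀ (ρ : Equiv.Perm (Fin m)) (P : Fin m → Prop),
      (∀ y, ρ y ≠ y ↔ P y ∧ θ y ≠ y) → ∀ y, θ y = y → ρ y = y := fun ρ P h y hy => by
    by_contra hne
    exact ((h y).1 hne).2 hy
  have hS₁ : ∀ y ∈ s '' {y | π.SameCycle a y}, y = b ∨ y ≠ b ∧ y ∈ A ∧ π.SameCycle a y := by
    rintro _ ⟨y, hy, rfl⟩
    have hyb : y ≠ b := fun h => hb (h ▸ hA1 y hy)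
    by_cases hya : y = a
    · left
      rw [hya, hs, Equiv.swap_apply_left]
    · right
      rw [hs, Equiv.swap_apply_of_ne_of_ne hya hyb]
      exact ⟨hyb, hA1 y hy, hy⟩
  have hinter : (s '' {y | π.SameCycle a y}) ∩ {y | θ₁.SameCycle b y} = {b} := by
    ext y
    constructor
    · rintro ⟨hy, hy'⟩
      rcases hS₁ y hy with h | h
      · exact h
      · exact absurd h.2.1 (hA2 y hy')
    · rintro rfl
      exact ⟨⟨a, Equiv.Perm.SameCycle.refl _ _, Equiv.swap_apply_left _ _⟩,
        Equiv.Perm.SameCycle.refl _ _⟩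
  obtain ⟨σ₁, σ₂, σ₃, hprod, hc1, hc2, hc3⟩ :=
    exists_three_cycles r ((CyclicOn.cycleOf π a).conj s) hEc (b := b) (ρ₁ := ρ₁) (ρ₂ := ρ₂)
      hinter
      (fun y hy => hfixes _ _ h1 y (by
        rcases hS₁ y hy with h | h
        · rw [h, hθb]
        · exact hθ5 y h.2.2))
      (fun y hy => hfixes _ _ h1 y (hθ3 y hy))
      (fun y hy => hfixes _ _ h2 y (hθ3 y hy))
      hd (fun c hc => hr c (hfac ▸ Finset.mem_union_left _ hc))
      (fun c hc => hr c (hfac ▸ Finset.mem_union_right _ hc))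
  rw [← hρ, ← hw] at hc1
  have hwa : w ≠ a := fun h => hpw (h ▸ rfl)
  have hc1' := hc1.mul (CyclicOn.swap w a) (x := w) (by
    ext y
    constructor
    · rintro ⟨h | ⟨c, hc, rfl⟩, h' | h'⟩
      · exact h
      · exact h
      · exact h'
      · exact absurd (by rw [h']) (hra c hc)
    · rintro rfl
      exact ⟨Set.mem_insert _ _, Set.mem_insert _ _⟩)
  refine ⟨σ₁ * Equiv.swap w a, σ₂, σ₃, hc1'.isPCycle ?_, hc2.isPCycle ?_, hc3.isPCycle ?_,
    fun x => ?_⟩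
  · have hset : insert w (r '' (θ.cycleFactorsFinset : Set (Equiv.Perm (Fin m)))) ∪ {w, a} =
        insert a (insert w (r '' (θ.cycleFactorsFinset : Set (Equiv.Perm (Fin m))))) := by
      ext y
      simp only [Set.mem_union, Set.mem_insert_iff, Set.mem_singleton_iff]
      tauto
    rw [hset]
    rintro x (hx | hx | ⟨c, hc, rfl⟩) y (hy | hy | ⟨d, hd, rfl⟩) h
    · rw [hx, hy]
    · exact absurd (by rw [← hx, ← hy, h]) hpw
    · exact absurd (by rw [← hx, h]) (hra d hd)
    · exact absurd (by rw [← hx, ← hy, h]) hpw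
    · rw [hx, hy]
    · exact absurd (by rw [← hx, h]) (hrw d hd)
    · exact absurd (by rw [← hy, h]) (hra c hc)
    · exact absurd (by rw [← hy, h]) (hrw c hc)
    · rw [hrinj c hc d hd h]
  · refine hpAc.mono ?_
    rintro y (hy | hy)
    · exact hA2 y hy
    · exact ((h2 y).1 hy).1
  · have hsub : (s '' {y | π.SameCycle a y}) ∪ {y | ρ₁ y ≠ y} ⊆ s '' A := by
      rintro y (⟨z, hz, rfl⟩ | hy)
      · exact ⟨z, hA1 z hz, rfl⟩
      · have hy' := (h1 y).1 hy
        refine ⟨y, hy'.1, Equiv.swap_apply_of_ne_of_ne ?_ ?_⟩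
        · rintro rfl
          exact hy'.2 hθa
        · rintro rfl
          exact hy'.2 hθb
    refine Set.InjOn.mono hsub ?_
    rintro _ ⟨x, hx, rfl⟩ _ ⟨y, hy, rfl⟩ h
    rw [hps, hps] at h
    rw [hpA hx hy h]
  · have hcomm : θ * Equiv.swap w a = Equiv.swap w a * θ := by
      rw [Equiv.mul_swap_eq_swap_mul, hθw, hθa]
    have hEs : s * E = E * Equiv.swap w a := by
      rw [hs, Equiv.swap_mul_eq_mul_swap, hEa, ← hw, Equiv.swap_comm]
    have hρE : ρ₁ * E = E * ρ₁ := by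
      refine Equiv.Perm.Disjoint.commute fun y => ?_
      by_cases hy : E y = y
      · exact Or.inr hy
      · exact Or.inl (hfixes _ _ h1 y (hθ3 y (hEc.1 y hy)))
    have hfinal : s * π = σ₃ * σ₂ * (σ₁ * Equiv.swap w a) := by
      rw [← mul_assoc (σ₃ * σ₂), ← hprod]
      calc s * π = s * D * s⁻¹ * (s * E) * θ := by
            rw [hπ, hθ]
            group
        _ = s * D * s⁻¹ * E * (θ * Equiv.swap w a) := by
            rw [hEs, hcomm]
            group
        _ = s * D * s⁻¹ * (E * ρ₁) * ρ₂ * Equiv.swap w a := by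
            rw [hρ]
            group
        _ = s * D * s⁻¹ * ρ₁ * (E * ρ₂) * Equiv.swap w a := by
            rw [← hρE]
            group
    rw [← hfinal, Equiv.Perm.mul_apply, hps]

/-- If all fibers of `p` have size at most 2 and `p, p'` have the same shape,
then there is a `p`-cycle decomposition of `(p, p')` of length at most 3. -/
theorem partition_polytope_diameter_three_of_fibers_le_two
    (m n : ℕ) (p p' : Fin m → Fin n)
    (hshape : ∀ i, fiberCard p i = fiberCard p' i)
    (hfib : ∀ i, fiberCard p i ≤ 2) :
    ∃ σ₁ σ₂ σ₃ : Equiv.Perm (Fin m),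
      IsPCycle p σ₁ ∧ IsPCycle p σ₂ ∧ IsPCycle p σ₃ ∧
      p' = p ∘ ⇑σ₃ ∘ ⇑σ₂ ∘ ⇑σ₁ := by
  obtain ⟨π, A, hπ, hA, hpA, hpAc⟩ := exists_perm_preserving_transversal hshape hfib
  have hA' : ∀ x, π x ∈ Aᶜ ↔ x ∈ Aᶜ := fun x => not_congr (hA x)
  have hpA' : Set.InjOn p Aᶜᶜ := by rwa [compl_compl]
  suffices h : ∃ σ₁ σ₂ σ₃ : Equiv.Perm (Fin m), IsPCycle p σ₁ ∧ IsPCycle p σ₂ ∧ IsPCycle p σ₃ ∧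
      ∀ x, p (π x) = p ((σ₃ * σ₂ * σ₁) x) by
    obtain ⟨σ₁, σ₂, σ₃, h1, h2, h3, h⟩ := h
    exact ⟨σ₁, σ₂, σ₃, h1, h2, h3, funext fun x => (hπ x).symm.trans (h x)⟩
  rcases isEmpty_or_nonempty (Fin m) with hm | ⟨⟨a⟩⟩
  · have h1 : IsPCycle p 1 := ⟨fun x => isEmptyElim x, Or.inl rfl⟩
    exact ⟨1, 1, 1, h1, h1, h1, fun x => isEmptyElim x⟩
  by_cases hlone : ∃ a, ∀ y, p y = p a → y ≠ a → π y = y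
  · obtain ⟨a, hl⟩ := hlone
    by_cases ha : a ∈ A
    · exact exists_pCycles_of_lonely hfib hA hpA hpAc ha hl
    · exact exists_pCycles_of_lonely hfib hA' hpAc hpA' ha hl
  · push Not at hlone
    obtain ⟨b, hab, hne, hπb⟩ := hlone a
    by_cases ha : a ∈ A
    · have hb : b ∉ A := fun hb => hne (hpA hb ha hab)
      exact exists_pCycles_of_partner_moved hfib hA hpA hpAc ha hb hab.symm hπb
    · have hb : b ∈ A := by
        by_contra hb
        exact hne (hpAc hb ha hab)
      exact exists_pCycles_of_partner_moved hfib hA' hpAc hpA' ha (not_not.2 hb) hab.symm hπb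
end

section
/- Let G be a polycycle on a finite vertex type α. Then G admits a path odd-cover of size at most 2 and a cycle odd-cover of size at most 2; that is, there is a family of at most 2 paths (respectively, at most 2 cycles) in the complete graph on α whose symmetric difference equals G. -/
/-- The degree of a vertex, as the cardinality of its neighbor set. -/
noncomputable def degS {α : Type*} (G : SimpleGraph α) (v : α) : ℕ := (G.neighborSet v).ncard

/-- A polycycle: every vertex has degree 0 or 2 (every component is a cycle). -/
def IsPolycycle {α : Type*} (G : SimpleGraph α) : Prop :=
  ∀ v, degS G v = 0 ∨ degS G v = 2

/-- A cycle graph: a nonempty connected graph in which every non-isolated vertex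
has degree 2. -/
def IsCycleGraph {α : Type*} (G : SimpleGraph α) : Prop :=
  G ≠ ⊥ ∧ (∀ v, degS G v = 0 ∨ degS G v = 2) ∧
    ∀ u v, 0 < degS G u → 0 < degS G v → G.Reachable u v

/-- A path graph: a graph whose edge set forms a nontrivial path. -/
def IsPathGraph {α : Type*} (G : SimpleGraph α) : Prop :=
  G ≠ ⊥ ∧ G.IsAcyclic ∧ (∀ v, degS G v ≤ 2) ∧
    ∀ u v, 0 < degS G u → 0 < degS G v → G.Reachable u v

/-- A linear forest: an acyclic graph of maximum degree at most 2. -/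
def IsLinearForest {α : Type*} (G : SimpleGraph α) : Prop :=
  G.IsAcyclic ∧ ∀ v, degS G v ≤ 2

/-- The symmetric difference of a family (list) of graphs: an edge belongs to it
iff it belongs to an odd number of members. -/
def listSymmDiff {α : Type*} (L : List (SimpleGraph α)) : SimpleGraph α :=
  L.foldr symmDiff ⊥

namespace SimpleGraph

variable {α : Type*}

lemma Walk.degS_spanningCoe_eq_zero {H : SimpleGraph α} {u v x : α} (p : H.Walk u v)
    (hx : x ∉ p.support) : degS p.toSubgraph.spanningCoe x = 0 := by
  have : p.toSubgraph.spanningCoe.neighborSet x = ∅ := by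
    ext y
    simp only [mem_neighborSet, Subgraph.spanningCoe_adj, Set.mem_empty_iff_false, iff_false]
    exact fun h => hx (p.mem_verts_toSubgraph.mp h.fst_mem)
  simp [degS, this]

lemma Walk.reachable_spanningCoe {H : SimpleGraph α} {u v x y : α} (p : H.Walk u v)
    (hx : 0 < degS p.toSubgraph.spanningCoe x) (hy : 0 < degS p.toSubgraph.spanningCoe y) :
    p.toSubgraph.spanningCoe.Reachable x y := by
  have mem : ∀ {z}, 0 < degS p.toSubgraph.spanningCoe z → z ∈ p.toSubgraph.verts := by
    intro z hz
    by_contra h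
    exact hz.ne' (p.degS_spanningCoe_eq_zero (by rwa [mem_verts_toSubgraph] at h))
  have := p.toSubgraph_connected.preconnected.coe ⟨x, mem hx⟩ ⟨y, mem hy⟩
  exact this.map ⟨Subtype.val, fun h => h⟩

lemma Walk.spanningCoe_adj_iff {H : SimpleGraph α} {u v a b : α} (p : H.Walk u v) :
    p.toSubgraph.spanningCoe.Adj a b ↔ s(a, b) ∈ p.edges := by
  rw [Subgraph.spanningCoe_adj, adj_toSubgraph_iff_mem_edges]

lemma Walk.IsPath.isAcyclic_spanningCoe {H : SimpleGraph α} {u v : α} {p : H.Walk u v}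
    (hp : p.IsPath) : p.toSubgraph.spanningCoe.IsAcyclic := by
  induction p with
  | nil =>
    convert isAcyclic_bot (V := α)
    ext a b
    simp
  | @cons u w v h p ih =>
    rw [cons_isPath_iff] at hp
    have hsup : (Walk.cons h p).toSubgraph.spanningCoe = p.toSubgraph.spanningCoe ⊔ edge u w := by
      ext a b
      rw [spanningCoe_adj_iff, sup_adj, spanningCoe_adj_iff, edge_adj, edges_cons, List.mem_cons]
      have := h.ne
      grind
    rw [hsup]
    refine (ih hp.1).sup_edge_of_not_reachable ?_
    rintro ⟨r⟩
    cases r with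
    | nil => exact h.ne rfl
    | cons h' _ => exact hp.2 (p.mem_verts_toSubgraph.mp (Subgraph.Adj.fst_mem h'))

lemma Walk.spanningCoe_ne_bot {H : SimpleGraph α} {u v : α} {p : H.Walk u v}
    (hp : ¬ p.Nil) : p.toSubgraph.spanningCoe ≠ ⊥ := by
  cases p with
  | nil => simp at hp
  | @cons _ w _ h p =>
    intro hb
    have : (Walk.cons h p).toSubgraph.spanningCoe.Adj u w := by
      rw [spanningCoe_adj_iff]
      simp
    rw [hb] at this
    exact this

lemma Walk.IsPath.isPathGraph {H : SimpleGraph α} {u v : α} {p : H.Walk u v}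
    (hp : p.IsPath) (huv : u ≠ v) : IsPathGraph p.toSubgraph.spanningCoe := by
  have hnil : ¬ p.Nil := not_nil_of_ne huv
  refine ⟨spanningCoe_ne_bot hnil, hp.isAcyclic_spanningCoe, fun x => ?_,
    fun _ _ => p.reachable_spanningCoe⟩
  by_cases hx : x ∈ p.support
  · obtain ⟨i, rfl, hi⟩ := mem_support_iff_exists_getVert.mp hx
    change (p.toSubgraph.neighborSet _).ncard ≤ 2
    rcases eq_or_ne i 0 with rfl | h0
    · rw [getVert_zero, hp.neighborSet_toSubgraph_startpoint hnil]
      simp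
    · rcases hi.lt_or_eq with hi | rfl
      · exact (hp.ncard_neighborSet_toSubgraph_internal_eq_two h0 hi).le
      · rw [getVert_length, hp.neighborSet_toSubgraph_endpoint hnil]
        simp
  · simp [p.degS_spanningCoe_eq_zero hx]

lemma Walk.IsCycle.isCycleGraph {H : SimpleGraph α} {u : α} {p : H.Walk u u}
    (hp : p.IsCycle) : IsCycleGraph p.toSubgraph.spanningCoe := by
  refine ⟨spanningCoe_ne_bot hp.not_nil, fun x => ?_, fun _ _ => p.reachable_spanningCoe⟩
  by_cases hx : x ∈ p.support
  · exact Or.inr (hp.ncard_neighborSet_toSubgraph_eq_two hx)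
  · exact Or.inl (p.degS_spanningCoe_eq_zero hx)

/-- Two paths with common distinct ends, inside the support of `G`, whose symmetric difference
is `G`. -/
structure PathPair (G : SimpleGraph α) where
  s : α
  t : α
  ne : s ≠ t
  p : (⊤ : SimpleGraph α).Walk s t
  q : (⊤ : SimpleGraph α).Walk s t
  hp : p.IsPath
  hq : q.IsPath
  p_support : ∀ x ∈ p.support, x ∈ G.support
  q_support : ∀ x ∈ q.support, x ∈ G.support
  adj_iff : ∀ a b, G.Adj a b ↔ Xor (s(a, b) ∈ p.edges) (s(a, b) ∈ q.edges)

lemma listSymmDiff_pair_eq {G : SimpleGraph α} {A B : SimpleGraph α}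
    (h : ∀ a b, G.Adj a b ↔ Xor (A.Adj a b) (B.Adj a b)) : listSymmDiff [A, B] = G := by
  ext a b
  rw [h]
  simp [listSymmDiff, symmDiff_def, Xor]

/-- Concatenation of two paths through a new edge. -/
def Walk.link {s t s' t' : α} (p : (⊤ : SimpleGraph α).Walk s t)
    (p' : (⊤ : SimpleGraph α).Walk s' t') (h : t ≠ s') : (⊤ : SimpleGraph α).Walk s t' :=
  p.append (.cons h p')

lemma Walk.mem_support_link {s t s' t' x : α} {p : (⊤ : SimpleGraph α).Walk s t}
    {p' : (⊤ : SimpleGraph α).Walk s' t'} {h : t ≠ s'} :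
    x ∈ (p.link p' h).support ↔ x ∈ p.support ∨ x ∈ p'.support := by
  have := p.end_mem_support
  simp only [link, mem_support_append_iff, support_cons, List.mem_cons]
  grind

lemma Walk.mem_edges_link {s t s' t' : α} {e : Sym2 α} {p : (⊤ : SimpleGraph α).Walk s t}
    {p' : (⊤ : SimpleGraph α).Walk s' t'} {h : t ≠ s'} :
    e ∈ (p.link p' h).edges ↔ e ∈ p.edges ∨ e = s(t, s') ∨ e ∈ p'.edges := by
  simp [link]

lemma Walk.IsPath.link {s t s' t' : α} {p : (⊤ : SimpleGraph α).Walk s t}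
    {p' : (⊤ : SimpleGraph α).Walk s' t'} (hp : p.IsPath) (hp' : p'.IsPath) (h : t ≠ s')
    (hd : p.support.Disjoint p'.support) : (p.link p' h).IsPath := by
  rw [isPath_def, Walk.link, support_append, support_cons, List.tail_cons]
  exact List.nodup_append'.mpr ⟨hp.support_nodup, hp'.support_nodup, hd⟩

namespace PathPair

variable {G G₁ G₂ : SimpleGraph α}

lemma fst_mem_support_of_mem_edges (A : PathPair G) {a b : α}
    (h : s(a, b) ∈ A.p.edges ∨ s(a, b) ∈ A.q.edges) : a ∈ G.support :=
  h.elim (fun h => A.p_support _ (A.p.fst_mem_support_of_mem_edges h))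
    fun h => A.q_support _ (A.q.fst_mem_support_of_mem_edges h)

lemma s_mem_support (A : PathPair G) : A.s ∈ G.support := A.p_support _ A.p.start_mem_support

lemma t_mem_support (A : PathPair G) : A.t ∈ G.support := A.p_support _ A.p.end_mem_support

lemma ne_of_disjoint_support (hd : Disjoint G₁.support G₂.support) {x y : α}
    (hx : x ∈ G₁.support) (hy : y ∈ G₂.support) : x ≠ y := by
  rintro rfl
  exact Set.disjoint_left.mp hd hx hy

lemma not_adj_of_disjoint_support (hd : Disjoint G₁.support G₂.support) {x y : α}
    (hx : x ∈ G₁.support) (hy : y ∈ G₂.support) : ¬ (G₁ ⊔ G₂).Adj x y := by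
  rintro (h | h)
  · exact Set.disjoint_left.mp hd (G₁.mem_support.mpr ⟨x, h.symm⟩) hy
  · exact Set.disjoint_left.mp hd hx (G₂.mem_support.mpr ⟨y, h⟩)

lemma sup_adj_iff_xor (hd : Disjoint G₁.support G₂.support) (A : PathPair G₁) (B : PathPair G₂)
    {x y : α} (hx : x ∈ G₁.support) (hy : y ∈ G₂.support) {a b : α} :
    (G₁ ⊔ G₂).Adj a b ↔
      Xor (s(a, b) ∈ A.p.edges ∨ s(a, b) = s(x, y) ∨ s(a, b) ∈ B.p.edges)
        (s(a, b) ∈ A.q.edges ∨ s(a, b) = s(x, y) ∨ s(a, b) ∈ B.q.edges) := by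
  have hA := A.fst_mem_support_of_mem_edges (a := a) (b := b)
  have hB := B.fst_mem_support_of_mem_edges (a := a) (b := b)
  have hAB : a ∈ G₁.support → a ∉ G₂.support := fun h => Set.disjoint_left.mp hd h
  by_cases hl : s(a, b) = s(x, y)
  · have hn := not_adj_of_disjoint_support hd hx hy
    rw [← mem_edgeSet, hl, mem_edgeSet]
    simp [hn, Xor]
  · rw [sup_adj, A.adj_iff, B.adj_iff]
    simp only [Xor, hl, false_or]
    tauto

lemma disjoint_p_support (hd : Disjoint G₁.support G₂.support) (A : PathPair G₁)
    (B : PathPair G₂) : A.p.support.Disjoint B.p.support := fun _ h h' =>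
  Set.disjoint_left.mp hd (A.p_support _ h) (B.p_support _ h')

lemma disjoint_q_support (hd : Disjoint G₁.support G₂.support) (A : PathPair G₁)
    (B : PathPair G₂) : A.q.support.Disjoint B.q.support := fun _ h h' =>
  Set.disjoint_left.mp hd (A.q_support _ h) (B.q_support _ h')

/-- Path pairs of two graphs with disjoint supports concatenate to a path pair of their union. -/
def join (hd : Disjoint G₁.support G₂.support) (A : PathPair G₁) (B : PathPair G₂) :
    PathPair (G₁ ⊔ G₂) where
  s := A.s
  t := B.t
  ne := ne_of_disjoint_support hd A.s_mem_support B.t_mem_support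
  p := A.p.link B.p (ne_of_disjoint_support hd A.t_mem_support B.s_mem_support)
  q := A.q.link B.q (ne_of_disjoint_support hd A.t_mem_support B.s_mem_support)
  hp := A.hp.link B.hp _ (disjoint_p_support hd A B)
  hq := A.hq.link B.hq _ (disjoint_q_support hd A B)
  p_support x hx := (Walk.mem_support_link.mp hx).elim
    (fun h => support_mono le_sup_left (A.p_support x h))
    fun h => support_mono le_sup_right (B.p_support x h)
  q_support x hx := (Walk.mem_support_link.mp hx).elim
    (fun h => support_mono le_sup_left (A.q_support x h))
    fun h => support_mono le_sup_right (B.q_support x h)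
  adj_iff a b := by
    rw [Walk.mem_edges_link, Walk.mem_edges_link]
    exact sup_adj_iff_xor hd A B A.t_mem_support B.s_mem_support

lemma exists_path_oddCover (A : PathPair G) :
    ∃ L : List (SimpleGraph α), L.length ≤ 2 ∧ (∀ P ∈ L, IsPathGraph P) ∧ listSymmDiff L = G := by
  refine ⟨[A.p.toSubgraph.spanningCoe, A.q.toSubgraph.spanningCoe], le_rfl, ?_,
    listSymmDiff_pair_eq fun a b => ?_⟩
  · simp [A.hp.isPathGraph A.ne, A.hq.isPathGraph A.ne]
  · rw [Walk.spanningCoe_adj_iff, Walk.spanningCoe_adj_iff, A.adj_iff]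

lemma exists_cycle_oddCover_sup (hd : Disjoint G₁.support G₂.support) (A : PathPair G₁)
    (B : PathPair G₂) :
    ∃ L : List (SimpleGraph α), L.length ≤ 2 ∧ (∀ C ∈ L, IsCycleGraph C) ∧
      listSymmDiff L = G₁ ⊔ G₂ := by
  have hne := ne_of_disjoint_support hd A.s_mem_support B.t_mem_support
  have hst := A.ne
  have hlink := ne_of_disjoint_support hd A.t_mem_support B.s_mem_support
  have hlast : s(B.t, A.s) ≠ s(A.t, B.s) := by
    intro h
    have := ne_of_disjoint_support hd A.t_mem_support B.t_mem_support
    grind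
  have hA : A.s ∉ G₂.support := fun h => Set.disjoint_left.mp hd A.s_mem_support h
  have hB : B.t ∉ G₁.support := fun h => Set.disjoint_left.mp hd h B.t_mem_support
  have hp : s(B.t, A.s) ∉ (A.p.link B.p hlink).edges := by
    rw [Walk.mem_edges_link]
    rintro (h | h | h)
    · exact hB (A.fst_mem_support_of_mem_edges (Or.inl h))
    · exact hlast h
    · exact hA (B.fst_mem_support_of_mem_edges (Or.inl (Sym2.eq_swap ▸ h)))
  have hq : s(B.t, A.s) ∉ (A.q.link B.q hlink).edges := by
    rw [Walk.mem_edges_link]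
    rintro (h | h | h)
    · exact hB (A.fst_mem_support_of_mem_edges (Or.inr h))
    · exact hlast h
    · exact hA (B.fst_mem_support_of_mem_edges (Or.inr (Sym2.eq_swap ▸ h)))
  have hadj : (⊤ : SimpleGraph α).Adj B.t A.s := hne.symm
  have hcp : (Walk.cons hadj (A.p.link B.p hlink)).IsCycle :=
    (Walk.cons_isCycle_iff _ _).mpr ⟨(join hd A B).hp, hp⟩
  have hcq : (Walk.cons hadj (A.q.link B.q hlink)).IsCycle :=
    (Walk.cons_isCycle_iff _ _).mpr ⟨(join hd A B).hq, hq⟩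
  refine ⟨[(Walk.cons hadj (A.p.link B.p hlink)).toSubgraph.spanningCoe,
    (Walk.cons hadj (A.q.link B.q hlink)).toSubgraph.spanningCoe], le_rfl,
    List.forall_mem_cons.mpr ⟨hcp.isCycleGraph, List.forall_mem_singleton.mpr hcq.isCycleGraph⟩,
    listSymmDiff_pair_eq fun a b => ?_⟩
  rw [Walk.spanningCoe_adj_iff, Walk.spanningCoe_adj_iff, Walk.edges_cons, Walk.edges_cons,
    List.mem_cons, List.mem_cons]
  by_cases hl : s(a, b) = s(B.t, A.s)
  · have hn := not_adj_of_disjoint_support hd A.s_mem_support B.t_mem_support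
    rw [adj_comm] at hn
    rw [← mem_edgeSet, hl, mem_edgeSet]
    simp [hn, Xor]
  · simp only [hl, false_or]
    exact (join hd A B).adj_iff a b

end PathPair

lemma Walk.IsCycle.nonempty_pathPair {H : SimpleGraph α} {v : α} {c : H.Walk v v}
    (hc : c.IsCycle) : Nonempty (PathPair c.toSubgraph.spanningCoe) := by
  have hadj : ∀ a b, c.toSubgraph.spanningCoe.Adj a b ↔ s(a, b) ∈ c.edges :=
    fun a b => c.spanningCoe_adj_iff
  have hsupp : ∀ x ∈ c.support, x ∈ c.toSubgraph.spanningCoe.support := by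
    intro x hx
    by_contra h
    have h2 := hc.ncard_neighborSet_toSubgraph_eq_two hx
    obtain ⟨y, hy⟩ := Set.nonempty_of_ncard_ne_zero (h2 ▸ two_ne_zero)
    exact h ⟨y, hy⟩
  cases c with
  | nil => simp at hc
  | @cons _ w _ h c =>
    rw [cons_isCycle_iff] at hc
    have hvw : (⊤ : SimpleGraph α).Adj w v := h.ne.symm
    refine ⟨⟨w, v, h.ne.symm, c.mapLe le_top, .cons hvw .nil, ?_, ?_, ?_, ?_, ?_⟩⟩
    · simpa using hc.1
    · simp [h.ne.symm]
    · intro x hx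
      exact hsupp x (by simp at hx; simp [hx])
    · intro x hx
      refine hsupp x ?_
      simp only [support_cons, support_nil, List.mem_cons, List.not_mem_nil, or_false] at hx
      rcases hx with rfl | rfl <;> simp
    · intro a b
      rw [hadj]
      have : s(a, b) = s(w, v) → s(a, b) ∉ c.edges := by
        rw [Sym2.eq_swap (a := w)]
        intro h
        exact h ▸ hc.2
      have hm : (c.mapLe (le_top : H ≤ ⊤)).edges = c.edges := by simp
      rw [hm]
      simp only [edges_cons, edges_nil, List.mem_cons, List.not_mem_nil, or_false, Xor]
      rw [Sym2.eq_swap (a := v)]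
      tauto

/-- A nonempty polycycle is the union of a cycle and a polycycle with disjoint supports. -/
lemma exists_isCycle_sup_eq [Finite α] {G : SimpleGraph α} (hG : IsPolycycle G) (hne : G ≠ ⊥) :
    ∃ (v : α) (c : G.Walk v v) (R : SimpleGraph α), c.IsCycle ∧ IsPolycycle R ∧
      Disjoint c.toSubgraph.spanningCoe.support R.support ∧
      c.toSubgraph.spanningCoe ⊔ R = G ∧ R < G := by
  classical
  have := Fintype.ofFinite α
  have hcyc : G.IsCycles := fun v hv =>
    (hG v).resolve_left ((Set.ncard_pos (Set.toFinite _)).mpr hv).ne'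
  obtain ⟨v, w, hvw⟩ := ne_bot_iff_exists_adj.mp hne
  obtain ⟨c, hc, -⟩ := hcyc.exists_cycle_toSubgraph_verts_eq_connectedComponentSupp
    (c := G.connectedComponentMk v) rfl ⟨w, hvw⟩
  have hadj : ∀ {x}, x ∈ c.toSubgraph.verts → ∀ y, c.toSubgraph.Adj x y ↔ G.Adj x y :=
    fun hx => hc.adj_toSubgraph_iff_of_isCycles hcyc hx
  have hle : c.toSubgraph.spanningCoe ≤ G := c.toSubgraph.spanningCoe_le
  refine ⟨v, c, G \ c.toSubgraph.spanningCoe, hc, fun x => ?_, ?_, sup_sdiff_cancel_right hle, ?_⟩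
  · by_cases hx : x ∈ c.toSubgraph.verts
    · left
      have : (G \ c.toSubgraph.spanningCoe).neighborSet x = ∅ := by
        ext y
        simp [hadj hx]
      simp [degS, this]
    · have : (G \ c.toSubgraph.spanningCoe).neighborSet x = G.neighborSet x := by
        ext y
        have : ¬ c.toSubgraph.Adj x y := fun h => hx h.fst_mem
        simp [this]
      rw [degS, this]
      exact hG x
  · rw [Set.disjoint_left]
    rintro x ⟨y, hy⟩ ⟨z, hz⟩
    exact hz.2 ((hadj (Subgraph.Adj.fst_mem hy) z).mpr hz.1)
  · refine sdiff_lt hle ?_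
    exact c.spanningCoe_ne_bot hc.not_nil

lemma nonempty_pathPair [Finite α] {G : SimpleGraph α} (hG : IsPolycycle G) (hne : G ≠ ⊥) :
    Nonempty (PathPair G) := by
  induction G using WellFoundedLT.induction with
  | ind G ih =>
    obtain ⟨v, c, R, hc, hR, hd, hsup, hlt⟩ := exists_isCycle_sup_eq hG hne
    obtain ⟨A⟩ := hc.nonempty_pathPair
    rcases eq_or_ne R ⊥ with rfl | hRne
    · rw [sup_bot_eq] at hsup
      exact hsup ▸ ⟨A⟩
    · obtain ⟨B⟩ := ih R hlt hR hRne
      exact hsup ▸ ⟨A.join hd B⟩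

lemma exists_cycle_oddCover [Finite α] {G : SimpleGraph α} (hG : IsPolycycle G) (hne : G ≠ ⊥) :
    ∃ L : List (SimpleGraph α), L.length ≤ 2 ∧ (∀ C ∈ L, IsCycleGraph C) ∧ listSymmDiff L = G := by
  obtain ⟨v, c, R, hc, hR, hd, hsup, -⟩ := exists_isCycle_sup_eq hG hne
  rcases eq_or_ne R ⊥ with rfl | hRne
  · rw [sup_bot_eq] at hsup
    exact ⟨[G], by simp, by simpa [hsup] using hc.isCycleGraph, by simp [listSymmDiff]⟩
  · obtain ⟨A⟩ := hc.nonempty_pathPair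
    obtain ⟨B⟩ := nonempty_pathPair hR hRne
    exact hsup ▸ A.exists_cycle_oddCover_sup hd B

end SimpleGraph

/-- Every polycycle admits a path odd-cover of size at most 2 and a cycle
odd-cover of size at most 2. -/
theorem polycycle_oddCover_two
    {α : Type*} [Fintype α] (G : SimpleGraph α) (hG : IsPolycycle G) :
    (∃ L : List (SimpleGraph α), L.length ≤ 2 ∧
        (∀ P ∈ L, IsPathGraph P) ∧ listSymmDiff L = G) ∧
    (∃ L : List (SimpleGraph α), L.length ≤ 2 ∧
        (∀ C ∈ L, IsCycleGraph C) ∧ listSymmDiff L = G) := by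
  rcases eq_or_ne G ⊥ with rfl | hne
  · exact ⟨⟨[], by simp [listSymmDiff]⟩, ⟨[], by simp [listSymmDiff]⟩⟩
  · obtain ⟨A⟩ := SimpleGraph.nonempty_pathPair hG hne
    exact ⟨A.exists_path_oddCover, SimpleGraph.exists_cycle_oddCover hG hne⟩
end

section
/- Let H₁ and H₂ be edge-disjoint polycycles on a finite vertex type, and let (M₁, M₂) be a transversal pair of matchings for (H₁, H₂) (each M_i consists of exactly one edge from each connected component of H_i). Then there exists a decomposition of H₁ ∪ H₂ into three pairwise edge-disjoint linear forests F₁, F₂, F₃ with F₁ ∪ F₂ ∪ F₃ = H₁ ∪ H₂ such that H₁ \ M₁ ⊆ F₁ ⊆ (H₁ \ M₁) ∪ M₂, M₁ ⊆ F₂ ⊆ M₁ ∪ M₂, and F₃ = H₂ \ M₂. -/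
/-- A matching: every vertex has degree at most 1. -/
def IsMatchingG {α : Type*} (M : SimpleGraph α) : Prop := ∀ v, degS M v ≤ 1

/-- `M` is transversal to `H`: `M ⊆ H` and `M` contains exactly one edge from
each connected component of `H` (containing an edge). -/
def Transversal {α : Type*} (M H : SimpleGraph α) : Prop :=
  M ≤ H ∧ ∀ u v, H.Adj u v →
    ∃! e : Sym2 α, e ∈ M.edgeSet ∧ ∃ w, w ∈ e ∧ H.Reachable u w

namespace SimpleGraph

variable {α : Type*}

/-- A vertex reachable from a set closed under adjacency lies in that set. -/
theorem Reachable.mem_of_closed {G : SimpleGraph α} {S : Set α} {u v : α}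
    (h : G.Reachable u v) (hS : ∀ a ∈ S, ∀ b, G.Adj a b → b ∈ S) (hu : u ∈ S) : v ∈ S := by
  obtain ⟨p⟩ := h
  induction p with
  | nil => exact hu
  | cons hab _ ih => exact ih (hS _ hu _ hab)

theorem degS_mono [Finite α] {G H : SimpleGraph α} (h : G ≤ H) (v : α) : degS G v ≤ degS H v :=
  Set.ncard_le_ncard (fun _ hw => h hw) (Set.toFinite _)

theorem degS_sup_le (G H : SimpleGraph α) (v : α) : degS (G ⊔ H) v ≤ degS G v + degS H v :=
  Set.ncard_union_le _ _

theorem _root_.IsPolycycle.degS_le_two {H : SimpleGraph α} (hH : IsPolycycle H) (v : α) :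
    degS H v ≤ 2 := by
  have := hH v
  lia

theorem _root_.IsMatchingG.eq_of_adj [Finite α] {M : SimpleGraph α} (hM : IsMatchingG M) {a b c : α}
    (hb : M.Adj a b) (hc : M.Adj a c) : b = c :=
  (Set.ncard_le_one_iff (Set.toFinite _)).1 (hM a) hb hc

theorem _root_.IsMatchingG.mono [Finite α] {M N : SimpleGraph α} (hM : IsMatchingG M) (h : N ≤ M) :
    IsMatchingG N :=
  fun v => (degS_mono h v).trans (hM v)

theorem Walk.IsCycle.two_le_degS [Finite α] {G : SimpleGraph α} {u v : α} {p : G.Walk u u}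
    (hp : p.IsCycle) (hv : v ∈ p.support) : 2 ≤ degS G v := by
  rw [← hp.ncard_neighborSet_toSubgraph_eq_two hv]
  exact Set.ncard_le_ncard (p.toSubgraph.neighborSet_subset v) (Set.toFinite _)

theorem _root_.IsMatchingG.isAcyclic [Finite α] {M : SimpleGraph α} (hM : IsMatchingG M) :
    M.IsAcyclic := by
  intro u p hp
  have := hp.two_le_degS p.start_mem_support
  have := hM u
  lia

/-- In a graph of maximum degree at most two, a cycle in a subgraph spans a whole component. -/
theorem Walk.IsCycle.adj_toSubgraph_of_reachable [Finite α] {G H : SimpleGraph α}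
    (hH : ∀ v, degS H v ≤ 2) (hGH : G ≤ H) {u v w : α} {p : G.Walk u u} (hp : p.IsCycle)
    (hv : H.Reachable u v) (hvw : H.Adj v w) : p.toSubgraph.Adj v w := by
  have key : ∀ a ∈ p.support, ∀ b, H.Adj a b → p.toSubgraph.Adj a b := by
    intro a ha b hab
    have hsub : p.toSubgraph.neighborSet a ⊆ H.neighborSet a :=
      fun x hx => hGH (p.toSubgraph.adj_sub hx)
    have heq := Set.eq_of_subset_of_ncard_le hsub
      ((hH a).trans (hp.ncard_neighborSet_toSubgraph_eq_two ha).ge) (Set.toFinite _)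
    exact heq.ge hab
  refine key v (hv.mem_of_closed (S := {x | x ∈ p.support}) ?_ p.start_mem_support) w hvw
  intro a ha b hab
  exact p.mem_verts_toSubgraph.1 (p.toSubgraph.edge_vert (key a ha b hab).symm)

theorem _root_.Transversal.isAcyclic_sdiff [Finite α] {M H : SimpleGraph α} (hT : Transversal M H)
    (hH : IsPolycycle H) : (H \ M).IsAcyclic := by
  intro u p hp
  have hadj : H.Adj u p.snd := (p.adj_snd hp.not_nil).1
  obtain ⟨e, ⟨he, w, hw, hr⟩, -⟩ := hT.2 u _ hadj
  obtain ⟨x, rfl⟩ := hw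
  exact (p.toSubgraph.adj_sub (hp.adj_toSubgraph_of_reachable hH.degS_le_two sdiff_le hr
    (hT.1 he))).2 he

theorem _root_.Transversal.isLinearForest_sdiff [Finite α] {M H : SimpleGraph α} (hT : Transversal M H)
    (hH : IsPolycycle H) : IsLinearForest (H \ M) :=
  ⟨hT.isAcyclic_sdiff hH, fun v => (degS_mono sdiff_le v).trans (hH.degS_le_two v)⟩

/-- The edge of a transversal in a given component covers only its own two endpoints there. -/
theorem _root_.Transversal.eq_or_eq_of_reachable {M H : SimpleGraph α} (hT : Transversal M H)
    {a b u x : α} (hux : M.Adj u x) (hab : M.Adj a b) (hr : H.Reachable u a) :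
    a = u ∨ a = x := by
  have := (hT.2 u x (hT.1 hux)).unique (y₁ := s(a, b)) (y₂ := s(u, x))
    ⟨hab, a, by simp, hr⟩ ⟨hux, u, by simp, .refl _⟩
  grind

/-- A matching `M₂` disjoint from a matching `M₁` has a subgraph `B` for which `M₁ ⊔ B` is acyclic
and such that each end of an edge in `M₂ \ B` has an `M₁`-partner incident to an edge of `B`. -/
theorem exists_isAcyclic_sup_of_isMatchingG [Finite α] {M₁ M₂ : SimpleGraph α}
    (hM₁ : IsMatchingG M₁) (hM₂ : IsMatchingG M₂) (hd : Disjoint M₁ M₂) :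
    ∃ B ≤ M₂, (M₁ ⊔ B).IsAcyclic ∧
      ∀ u v, (M₂ \ B).Adj u v → ∃ x y, M₁.Adj u x ∧ B.Adj x y := by
  obtain ⟨B, hB⟩ := (Set.toFinite {B | B ≤ M₂ ∧ (M₁ ⊔ B).IsAcyclic}).exists_maximal
    ⟨⊥, bot_le, by simpa using IsMatchingG.isAcyclic hM₁⟩
  obtain ⟨hBM, hBa⟩ := hB.prop
  refine ⟨B, hBM, hBa, fun u v huv => ?_⟩
  have hle : edge u v ≤ M₂ := (edge_le_iff _).2 (.inr huv.1)
  have hr : (M₁ ⊔ B).Reachable u v := by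
    by_contra hr
    refine huv.2 (hB.le_of_ge (y := B ⊔ edge u v) ⟨sup_le hBM hle, ?_⟩ le_sup_left ?_)
    · rw [← sup_assoc]
      exact hBa.sup_edge_of_not_reachable hr
    · exact .inr (by simp [edge_adj, huv.1.ne])
  have hBu : ∀ x, ¬ B.Adj u x := fun x hx =>
    huv.2 (IsMatchingG.eq_of_adj hM₂ (hBM hx) huv.1 ▸ hx)
  obtain ⟨x, hx⟩ : ∃ x, M₁.Adj u x := by
    by_contra! h
    have := hr.mem_of_closed (S := {u}) (by
      rintro _ rfl b (hb | hb)
      exacts [(h b hb).elim, (hBu b hb).elim]) rfl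
    exact huv.1.ne this.symm
  refine ⟨x, ?_⟩
  by_contra! h
  have hv := hr.mem_of_closed (S := {u, x}) (by
    rintro _ (rfl | rfl) b (hb | hb)
    · exact .inr (IsMatchingG.eq_of_adj hM₁ hb hx)
    · exact (hBu b hb).elim
    · exact .inl (IsMatchingG.eq_of_adj hM₁ hb hx.symm)
    · exact (h b hx hb).elim) (.inl rfl)
  rcases hv with rfl | rfl
  · exact huv.1.ne rfl
  · exact hd.le_bot ⟨hx, huv.1⟩

/-- Adding a matching `A` to `H \ M` keeps it a linear forest if each end of an edge of `A` has an
`M`-partner not covered by `A`. -/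
theorem _root_.Transversal.isLinearForest_sdiff_sup [Finite α] {M H A : SimpleGraph α}
    (hT : Transversal M H) (hH : IsPolycycle H) (hA : IsMatchingG A)
    (hAM : ∀ u v, A.Adj u v → ∃ x, M.Adj u x ∧ ∀ y, ¬ A.Adj x y) :
    IsLinearForest (H \ M ⊔ A) := by
  constructor
  · intro c p hp
    by_cases hpA : ∀ e ∈ p.edges, e ∈ (H \ M).edgeSet
    · exact hT.isAcyclic_sdiff hH _ (hp.transfer hpA)
    push Not at hpA
    obtain ⟨e, hep, heH⟩ := hpA
    induction e with | h u v
    have huv : A.Adj u v := (p.adj_of_mem_edges hep).resolve_left heH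
    obtain ⟨-, hr⟩ := adj_and_reachable_delete_edges_iff_exists_cycle.2 ⟨c, p, hp, hep⟩
    obtain ⟨x, hux, hx⟩ := hAM u v huv
    have hcov : ∀ a b, H.Reachable u a → A.Adj a b → a = u := by
      intro a b hra hab
      obtain ⟨y, hy, -⟩ := hAM a b hab
      refine (hT.eq_or_eq_of_reachable hux hy hra).resolve_right ?_
      rintro rfl
      exact hx b hab
    have hv := hr.mem_of_closed (S := {a | H.Reachable u a}) (by
      intro a ha b hab
      rw [deleteEdges_adj] at hab
      obtain ⟨hab | hab, hne⟩ := hab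
      · exact Reachable.trans ha hab.1.reachable
      · obtain rfl := hcov a b ha hab
        exact (hne (by simp [IsMatchingG.eq_of_adj hA hab huv])).elim) (Reachable.refl u)
    exact huv.ne (hcov v u hv huv.symm).symm
  · intro v
    have hle := degS_sup_le (H \ M) A v
    have hAv := hA v
    by_cases h : ∃ w, A.Adj v w
    · obtain ⟨w, hw⟩ := h
      obtain ⟨x, hx, -⟩ := hAM v w hw
      have hlt : degS (H \ M) v < degS H v :=
        Set.ncard_lt_ncard (Set.ssubset_iff_of_subset (fun _ h => h.1) |>.2
          ⟨x, hT.1 hx, fun h => h.2 hx⟩) (Set.toFinite _)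
      have := IsPolycycle.degS_le_two hH v
      lia
    · have hzero : degS A v = 0 := by
        rw [degS, Set.ncard_eq_zero (Set.toFinite _)]
        exact Set.eq_empty_iff_forall_notMem.2 fun w hw => h ⟨w, hw⟩
      have := (degS_mono (sdiff_le : H \ M ≤ H) v).trans (IsPolycycle.degS_le_two hH v)
      lia

end SimpleGraph

open SimpleGraph in
/-- Splitting two edge-disjoint polycycles along a transversal pair of matchings
into three linear forests. -/
theorem three_linear_forests_from_transversal_pair
    {α : Type*} [Fintype α] (H₁ H₂ M₁ M₂ : SimpleGraph α)
    (hH₁ : IsPolycycle H₁) (hH₂ : IsPolycycle H₂) (hdisj : Disjoint H₁ H₂)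
    (hM₁ : IsMatchingG M₁) (hM₂ : IsMatchingG M₂)
    (hT₁ : Transversal M₁ H₁) (hT₂ : Transversal M₂ H₂) :
    ∃ F₁ F₂ F₃ : SimpleGraph α,
      IsLinearForest F₁ ∧ IsLinearForest F₂ ∧ IsLinearForest F₃ ∧
      Disjoint F₁ F₂ ∧ Disjoint F₁ F₃ ∧ Disjoint F₂ F₃ ∧
      F₁ ⊔ F₂ ⊔ F₃ = H₁ ⊔ H₂ ∧
      H₁ \ M₁ ≤ F₁ ∧ F₁ ≤ (H₁ \ M₁) ⊔ M₂ ∧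
      M₁ ≤ F₂ ∧ F₂ ≤ M₁ ⊔ M₂ ∧
      F₃ = H₂ \ M₂ := by
  have hM := hdisj.mono hT₁.1 hT₂.1
  obtain ⟨B, hB, hacyc, hpartner⟩ := exists_isAcyclic_sup_of_isMatchingG hM₁ hM₂ hM
  have hH₁₂ : Disjoint H₁ M₂ := hdisj.mono_right hT₂.1
  have hMH : Disjoint M₁ (H₂ \ M₂) := hdisj.mono hT₁.1 sdiff_le
  have hF₁ : IsLinearForest (H₁ \ M₁ ⊔ M₂ \ B) := by
    refine hT₁.isLinearForest_sdiff_sup hH₁ (hM₂.mono sdiff_le) fun u v huv => ?_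
    obtain ⟨x, y, hux, hxy⟩ := hpartner u v huv
    refine ⟨x, hux, fun z hz => hz.2 ?_⟩
    exact hM₂.eq_of_adj (hB hxy) hz.1 ▸ hxy
  have hF₂ : IsLinearForest (M₁ ⊔ B) := by
    refine ⟨hacyc, fun v => (degS_sup_le M₁ B v).trans ?_⟩
    exact add_le_add (hM₁ v) ((hM₂.mono hB) v)
  refine ⟨H₁ \ M₁ ⊔ M₂ \ B, M₁ ⊔ B, H₂ \ M₂, hF₁, hF₂, hT₂.isLinearForest_sdiff hH₂,
    ?_, ?_, ?_, ?_, le_sup_left, sup_le_sup_left sdiff_le _, le_sup_left,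
    sup_le_sup_left hB _, rfl⟩
  · exact .sup_left (.sup_right disjoint_sdiff_self_left (hH₁₂.mono sdiff_le hB))
      (.sup_right (hM.symm.mono_left sdiff_le) disjoint_sdiff_self_left)
  · exact .sup_left (hdisj.mono sdiff_le sdiff_le) (disjoint_sdiff_self_right.mono_left sdiff_le)
  · exact .sup_left hMH (disjoint_sdiff_self_right.mono_left hB)
  · calc H₁ \ M₁ ⊔ M₂ \ B ⊔ (M₁ ⊔ B) ⊔ H₂ \ M₂
        = (H₁ \ M₁ ⊔ M₁) ⊔ (H₂ \ M₂ ⊔ (M₂ \ B ⊔ B)) := by ac_rfl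
      _ = H₁ ⊔ H₂ := by
        rw [sdiff_sup_cancel hT₁.1, sdiff_sup_cancel hB, sdiff_sup_cancel hT₂.1]
end

section
/- Let α be a finite type and let M₁ and M₂ be two matchings in the complete graph on α (sets of pairwise vertex-disjoint unordered pairs of distinct elements of α). Then there exists a subset S ⊆ α such that every edge of M₁ and every edge of M₂ has exactly one endpoint in S and exactly one endpoint in the complement of S. -/
/-- If `f` and `g` are fixed-point-free involutions, then `f x` never lies in the same cycle
of `g * f` as `x`. -/
theorem not_sameCycle_mul_of_involutive {β : Type*} {f g : Equiv.Perm β}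
    (hf : f * f = 1) (hg : g * g = 1) (hfx : ∀ x, f x ≠ x) (hgx : ∀ x, g x ≠ x) (x : β) :
    ¬ (g * f).SameCycle x (f x) := by
  rintro ⟨k, hk⟩
  have conj_pow : ∀ m : ℤ, f * (g * f) ^ m = (g * f) ^ (-m) * f := by
    intro m
    have hfi : f⁻¹ = f := inv_eq_of_mul_eq_one_left hf
    have hgi : g⁻¹ = g := inv_eq_of_mul_eq_one_left hg
    have h : SemiconjBy f (g * f) (g * f)⁻¹ := by
      rw [SemiconjBy, mul_inv_rev, hfi, hgi, mul_assoc]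
    simpa only [SemiconjBy, inv_zpow'] using h.zpow_right m
  have cancel : ∀ m : ℤ, f (((g * f) ^ m) x) = ((g * f) ^ (k - m)) x := by
    intro m
    have h := congrArg (fun p : Equiv.Perm β => p x) (conj_pow m)
    simp only [Equiv.Perm.mul_apply] at h
    rw [h, ← hk, ← Equiv.Perm.mul_apply, ← zpow_add]
    congr 2
    ring
  rcases Int.even_or_odd' k with ⟨m, rfl | rfl⟩
  · apply hfx (((g * f) ^ m) x)
    rw [cancel]
    congr 2
    ring
  · apply hgx (f (((g * f) ^ m) x))
    rw [← Equiv.Perm.mul_apply, ← Equiv.Perm.mul_apply, ← zpow_one_add, cancel]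
    congr 2
    ring

/-- Two fixed-point-free involutions admit a common set that both of them exchange with its
complement. -/
theorem exists_set_swapped_by_involutions {β : Type*} {f g : Equiv.Perm β}
    (hf : f * f = 1) (hg : g * g = 1) (hfx : ∀ x, f x ≠ x) (hgx : ∀ x, g x ≠ x) :
    ∃ S : Set β, ∀ x, (f x ∈ S ↔ x ∉ S) ∧ (g x ∈ S ↔ x ∉ S) := by
  let q : β → Quotient (Equiv.Perm.SameCycle.setoid (g * f)) := Quotient.mk _
  have hff : ∀ x, f (f x) = x := fun x => Equiv.congr_fun hf x
  have hgg : ∀ x, g (g x) = x := fun x => Equiv.congr_fun hg x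
  have hne : ∀ x, q x ≠ q (f x) := fun x h =>
    not_sameCycle_mul_of_involutive hf hg hfx hgx x (Quotient.exact h)
  have hqgf : ∀ x, q (g (f x)) = q x := fun x =>
    (Quotient.sound (⟨1, by simp⟩ : (g * f).SameCycle x (g (f x)))).symm
  have hqg : ∀ x, q (g x) = q (f x) := fun x => by simpa [hff] using hqgf (f x)
  have hqfg : ∀ x, q (f (g x)) = q x := fun x => by rw [← hqg, hgg]
  have hr : ∀ x, WellOrderingRel (q (f x)) (q x) ↔ ¬ WellOrderingRel (q x) (q (f x)) := by
    intro x
    refine ⟨fun h h' => asymm h h', fun h => ?_⟩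
    rcases trichotomous_of WellOrderingRel (q x) (q (f x)) with h' | h' | h'
    · exact absurd h' h
    · exact absurd h' (hne x)
    · exact h'
  refine ⟨{x | WellOrderingRel (q x) (q (f x))}, fun x => ⟨?_, ?_⟩⟩
  · simpa [hff] using hr x
  · simpa [hqg, hqfg] using hr x

/-- A finite graph of maximum degree at most one is induced by a fixed-point-free involution of
two disjoint copies of its vertex set. -/
theorem exists_involution_of_degS_le_one {α : Type*} [Finite α] (M : SimpleGraph α)
    (hM : ∀ v, degS M v ≤ 1) :
    ∃ f : Equiv.Perm (α × Bool), f * f = 1 ∧ (∀ x, f x ≠ x) ∧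
      ∀ u v i, M.Adj u v → f (u, i) = (v, i) := by
  classical
  have huniq : ∀ {u v w}, M.Adj u v → M.Adj u w → v = w := fun {u v w} hv hw =>
    (Set.ncard_le_one (Set.toFinite _)).1 (hM u) v hv w hw
  let F : α × Bool → α × Bool := fun x =>
    if h : ∃ w, M.Adj x.1 w then (h.choose, x.2) else (x.1, !x.2)
  have hadj : ∀ u v i, M.Adj u v → F (u, i) = (v, i) := by
    intro u v i h
    have hex : ∃ w, M.Adj u w := ⟨v, h⟩
    simp only [F, dif_pos hex, huniq hex.choose_spec h]
  have hiso : ∀ u i, (¬ ∃ w, M.Adj u w) → F (u, i) = (u, !i) := fun u i h => dif_neg h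
  have hinv : Function.Involutive F := by
    rintro ⟨u, i⟩
    by_cases h : ∃ w, M.Adj u w
    · obtain ⟨w, hw⟩ := h
      rw [hadj u w i hw, hadj w u i hw.symm]
    · rw [hiso u i h, hiso u _ h, Bool.not_not]
  refine ⟨hinv.toPerm, Equiv.ext hinv, ?_, hadj⟩
  rintro ⟨u, i⟩ (hfix : F (u, i) = (u, i))
  by_cases h : ∃ w, M.Adj u w
  · obtain ⟨w, hw⟩ := h
    rw [hadj u w i hw] at hfix
    exact hw.ne' (congrArg Prod.fst hfix)
  · rw [hiso u i h] at hfix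
    simp at hfix

/-- For two matchings `M₁, M₂`, the vertex set can be split into `S` and its
complement so that every edge of either matching has exactly one endpoint in
`S`. -/
theorem matchings_bipartition
    {α : Type*} [Fintype α] (M₁ M₂ : SimpleGraph α)
    (h₁ : ∀ v, degS M₁ v ≤ 1) (h₂ : ∀ v, degS M₂ v ≤ 1) :
    ∃ S : Set α, ∀ u v, M₁.Adj u v ∨ M₂.Adj u v →
      ((u ∈ S ∧ v ∉ S) ∨ (u ∉ S ∧ v ∈ S)) := by
  obtain ⟨f, hf, hfx, hfM⟩ := exists_involution_of_degS_le_one M₁ h₁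
  obtain ⟨g, hg, hgx, hgM⟩ := exists_involution_of_degS_le_one M₂ h₂
  obtain ⟨S, hS⟩ := exists_set_swapped_by_involutions hf hg hfx hgx
  refine ⟨{v | (v, true) ∈ S}, fun u v h => ?_⟩
  have hswap : (v, true) ∈ S ↔ (u, true) ∉ S := by
    rcases h with h | h
    · simpa [hfM u v true h] using (hS (u, true)).1
    · simpa [hgM u v true h] using (hS (u, true)).2
  simp only [Set.mem_ofPred_eq]
  tauto
end
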